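/- arXiv:2512.13181 — 3 statements merged into one kernel-verified Lean document; each statement's English description precedes it below -/
import Mathlib

section
/- Let d ≥ 2 be an integer, let f : ℝ^d → ℝ be C² and convex, and let u : ℝ^d → ℝ be a non-negative C³ function satisfying Δu − ∇f·∇u + u^p = 0 on all of ℝ^d for some real p with 1 < p and (d−2)p < d+2 (i.e., p is Sobolev-subcritical; for d = 2 this allows every p > 1). Assume ∇f(x)·∇u(x) ≤ 0 for every x ∈ ℝ^d, and that there exist o ∈ ℝ^d and C > 0 such that ∫_{B_R(o)} e^{−f(x)} dx ≤ C·R^d for all R ≥ 1. Then u ≡ 0. [Euclidean-base instance of Theorem 2.3.] -/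
open Real MeasureTheory Filter
open scoped RealInnerProductSpace

/-- Euclidean Laplacian: trace of the second derivative. -/
noncomputable def lapl {d : ℕ} (u : EuclideanSpace ℝ (Fin d) → ℝ)
    (x : EuclideanSpace ℝ (Fin d)) : ℝ :=
  ∑ i : Fin d, iteratedFDeriv ℝ 2 u x ![EuclideanSpace.single i 1, EuclideanSpace.single i 1]

/-- Partial derivative. -/
noncomputable def pd {d : ℕ} (i : Fin d) (g : EuclideanSpace ℝ (Fin d) → ℝ)
    (x : EuclideanSpace ℝ (Fin d)) : ℝ := fderiv ℝ g x (EuclideanSpace.single i 1)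

lemma pd_contDiff {d : ℕ} (i : Fin d) {g : EuclideanSpace ℝ (Fin d) → ℝ} {n m : WithTop ℕ∞}
    (hg : ContDiff ℝ n g) (h : m + 1 ≤ n) : ContDiff ℝ m (pd i g) :=
  (hg.fderiv_right h).clm_apply contDiff_const

lemma pd_line {d : ℕ} (i : Fin d) {g : EuclideanSpace ℝ (Fin d) → ℝ}
    {x : EuclideanSpace ℝ (Fin d)} (hg : DifferentiableAt ℝ g x) :
    HasLineDerivAt ℝ g (pd i g x) x (EuclideanSpace.single i 1) :=
  hg.hasFDerivAt.hasLineDerivAt _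

lemma pd_eq {d : ℕ} {i : Fin d} {g : EuclideanSpace ℝ (Fin d) → ℝ}
    {x : EuclideanSpace ℝ (Fin d)} {c : ℝ} (hg : DifferentiableAt ℝ g x)
    (h : HasLineDerivAt ℝ g c x (EuclideanSpace.single i 1)) : pd i g x = c :=
  (pd_line i hg).unique h

lemma pd_pd {d : ℕ} (i j : Fin d) {g : EuclideanSpace ℝ (Fin d) → ℝ} (hg : ContDiff ℝ 2 g)
    (x : EuclideanSpace ℝ (Fin d)) : pd i (pd j g) x =
      fderiv ℝ (fderiv ℝ g) x (EuclideanSpace.single i 1) (EuclideanSpace.single j 1) := by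
  unfold pd
  have h : DifferentiableAt ℝ (fderiv ℝ g) x :=
    ((hg.fderiv_right (m := 1) (by norm_num)).differentiable (by norm_num)) x
  rw [fderiv_clm_apply h (by fun_prop)]
  simp

lemma pd_comm {d : ℕ} (i j : Fin d) {g : EuclideanSpace ℝ (Fin d) → ℝ} (hg : ContDiff ℝ 2 g)
    (x : EuclideanSpace ℝ (Fin d)) : pd i (pd j g) x = pd j (pd i g) x := by
  rw [pd_pd i j hg, pd_pd j i hg]
  exact (hg.contDiffAt.isSymmSndFDerivAt (by simp)) _ _

lemma lapl_eq {d : ℕ} {g : EuclideanSpace ℝ (Fin d) → ℝ} (hg : ContDiff ℝ 2 g)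
    (x : EuclideanSpace ℝ (Fin d)) : lapl g x = ∑ i, pd i (pd i g) x := by
  unfold lapl
  refine Finset.sum_congr rfl fun i _ => ?_
  rw [pd_pd i i hg, iteratedFDeriv_two_apply]
  simp

lemma inner_gradient_eq {d : ℕ} {f g : EuclideanSpace ℝ (Fin d) → ℝ}
    (x : EuclideanSpace ℝ (Fin d)) :
    ⟪gradient f x, gradient g x⟫ = ∑ i, pd i f x * pd i g x := by
  have key : ∀ (h : EuclideanSpace ℝ (Fin d) → ℝ) (i : Fin d),
      gradient h x i = pd i h x := by
    intro h i
    have : ⟪gradient h x, EuclideanSpace.single i (1:ℝ)⟫ = pd i h x := by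
      unfold pd gradient
      simp
    rw [← this, EuclideanSpace.inner_single_right]
    simp
  simp only [PiLp.inner_apply, key]
  refine Finset.sum_congr rfl fun i _ => ?_
  simp [mul_comm]

/-- Weighted divergence theorem. -/
lemma div_thm {d : ℕ} {f : EuclideanSpace ℝ (Fin d) → ℝ} (hf : ContDiff ℝ 2 f)
    (F : Fin d → EuclideanSpace ℝ (Fin d) → ℝ) (hF : ∀ i, ContDiff ℝ 1 (F i))
    (hs : ∀ i, HasCompactSupport (F i)) :
    Integrable (fun x => (∑ i, (pd i (F i) x - pd i f x * F i x)) * Real.exp (-f x)) ∧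
    ∫ x, (∑ i, (pd i (F i) x - pd i f x * F i x)) * Real.exp (-f x) = 0 := by
  have hfc := hf.continuous
  have hpf : ∀ i, Continuous (pd i f) := fun i =>
    (pd_contDiff (m := 1) i hf (by norm_num)).continuous
  have hpF : ∀ i, Continuous (pd i (F i)) := fun i =>
    (pd_contDiff (m := 0) i (hF i) (by norm_num)).continuous
  have hFc : ∀ i, Continuous (F i) := fun i => (hF i).continuous
  have hsp : ∀ i, HasCompactSupport (pd i (F i)) := fun i =>
    (hs i).fderiv_apply ℝ _
  have hexp : ∀ x i, pd i (fun y => Real.exp (-f y)) x = - (pd i f x * Real.exp (-f x)) := by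
    intro x i
    unfold pd
    have hd : HasFDerivAt f (fderiv ℝ f x) x :=
      ((hf.differentiable (by norm_num)) x).hasFDerivAt
    have hd2 : HasFDerivAt (fun y => Real.exp (-f y)) (Real.exp (-f x) • (-fderiv ℝ f x)) x :=
      hd.neg.exp
    rw [hd2.fderiv]
    simp [mul_comm]
  have I1 : ∀ i, Integrable (fun x => pd i (F i) x * Real.exp (-f x)) := fun i =>
    Continuous.integrable_of_hasCompactSupport (by have := hpF i; fun_prop) ((hsp i).mul_right)
  have I2 : ∀ i, Integrable (fun x => F i x * (pd i (fun y => Real.exp (-f y)) x)) := by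
    intro i
    have : (fun x => F i x * (pd i (fun y => Real.exp (-f y)) x))
        = fun x => F i x * (- (pd i f x * Real.exp (-f x))) := by
      funext x
      rw [hexp x i]
    rw [this]
    exact Continuous.integrable_of_hasCompactSupport
      (by have := hpf i; have := hFc i; fun_prop) ((hs i).mul_right)
  have I3 : ∀ i, Integrable (fun x => F i x * Real.exp (-f x)) := fun i =>
    Continuous.integrable_of_hasCompactSupport (by have := hFc i; fun_prop) ((hs i).mul_right)
  have key : ∀ i, ∫ x, F i x * (pd i (fun y => Real.exp (-f y)) x)
      = - ∫ x, pd i (F i) x * Real.exp (-f x) := fun i =>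
    integral_mul_fderiv_eq_neg_fderiv_mul_of_integrable (I1 i) (I2 i) (I3 i)
      (fun x _ => ((hF i).differentiable (by norm_num)) x)
      (fun x _ => ((hf.differentiable (by norm_num)).neg.exp) x)
  have e : (fun x => (∑ i, (pd i (F i) x - pd i f x * F i x)) * Real.exp (-f x))
      = fun x => ∑ i, (pd i (F i) x * Real.exp (-f x)
          + F i x * (pd i (fun y => Real.exp (-f y)) x)) := by
    funext x
    rw [Finset.sum_mul]
    refine Finset.sum_congr rfl fun i _ => ?_
    rw [hexp x i]
    ring
  rw [e]
  have I4 : ∀ i, Integrable (fun x => pd i (F i) x * Real.exp (-f x)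
          + F i x * (pd i (fun y => Real.exp (-f y)) x)) := fun i => (I1 i).add (I2 i)
  refine ⟨integrable_finsetSum _ fun i _ => I4 i, ?_⟩
  rw [integral_finsetSum _ fun i _ => I4 i]
  refine Finset.sum_eq_zero fun i _ => ?_
  rw [integral_add (I1 i) (I2 i), key i]
  ring

lemma ld_mul {d : ℕ} {f g : EuclideanSpace ℝ (Fin d) → ℝ} {f' g' : ℝ}
    {x v : EuclideanSpace ℝ (Fin d)} (hf : HasLineDerivAt ℝ f f' x v)
    (hg : HasLineDerivAt ℝ g g' x v) :
    HasLineDerivAt ℝ (fun y => f y * g y) (f' * g x + f x * g') x v := by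
  have := HasDerivAt.mul hf hg
  simp only [zero_smul, add_zero] at this
  exact this

lemma ld_add {d : ℕ} {f g : EuclideanSpace ℝ (Fin d) → ℝ} {f' g' : ℝ}
    {x v : EuclideanSpace ℝ (Fin d)} (hf : HasLineDerivAt ℝ f f' x v)
    (hg : HasLineDerivAt ℝ g g' x v) :
    HasLineDerivAt ℝ (fun y => f y + g y) (f' + g') x v := 
  HasDerivAt.add hf hg

lemma ld_sum {d : ℕ} {ι : Type*} {s : Finset ι} {f : ι → EuclideanSpace ℝ (Fin d) → ℝ}
    {f' : ι → ℝ} {x v : EuclideanSpace ℝ (Fin d)}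
    (hf : ∀ i ∈ s, HasLineDerivAt ℝ (f i) (f' i) x v) :
    HasLineDerivAt ℝ (fun y => ∑ i ∈ s, f i y) (∑ i ∈ s, f' i) x v := 
  HasDerivAt.fun_sum hf

lemma ld_const_mul {d : ℕ} (c : ℝ) {g : EuclideanSpace ℝ (Fin d) → ℝ} {g' : ℝ}
    {x v : EuclideanSpace ℝ (Fin d)} 
    (hg : HasLineDerivAt ℝ g g' x v) :
    HasLineDerivAt ℝ (fun y => c * g y) (c * g') x v := 
  HasDerivAt.const_mul c hg

lemma ld_pow {d : ℕ} {f : EuclideanSpace ℝ (Fin d) → ℝ} {f' : ℝ}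
    {x v : EuclideanSpace ℝ (Fin d)} (hf : HasLineDerivAt ℝ f f' x v) (m : ℕ) :
    HasLineDerivAt ℝ (fun y => f y ^ m) (m * f x ^ (m - 1) * f') x v := by
  have := HasDerivAt.pow hf m
  simp only [zero_smul, add_zero] at this
  exact this

lemma ld_rpow {d : ℕ} {f : EuclideanSpace ℝ (Fin d) → ℝ} {f' : ℝ}
    {x v : EuclideanSpace ℝ (Fin d)} (hf : HasLineDerivAt ℝ f f' x v) (h0 : 0 < f x) (a : ℝ) :
    HasLineDerivAt ℝ (fun y => f y ^ a) (a * f x ^ (a - 1) * f') x v := by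
  have := HasDerivAt.rpow_const (p := a) hf (Or.inl (by simpa using h0.ne'))
  simp only [zero_smul, add_zero] at this
  rw [show a * f x ^ (a - 1) * f' = f' * a * f x ^ (a - 1) by ring]
  exact this


/-- Family of cutoffs. -/
lemma exists_cutoff {d : ℕ} (o : EuclideanSpace ℝ (Fin d)) :
    ∃ M : ℝ, 0 < M ∧ ∀ R : ℝ, 1 ≤ R → ∃ φ : EuclideanSpace ℝ (Fin d) → ℝ,
      ContDiff ℝ 1 φ ∧ (∀ x, 0 ≤ φ x) ∧ (∀ x, φ x ≤ 1) ∧ (∀ x ∈ Metric.ball o 1, φ x = 1) ∧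
      (∀ x, x ∉ Metric.ball o (2 * R) → φ x = 0) ∧ HasCompactSupport φ ∧
      ∀ i x, |pd i φ x| ≤ M / R := by
  let b : ContDiffBump (0 : EuclideanSpace ℝ (Fin d)) := ⟨1, 2, by norm_num, by norm_num⟩
  have hb : ContDiff ℝ 1 (b : EuclideanSpace ℝ (Fin d) → ℝ) := b.contDiff
  have hc : Continuous (fderiv ℝ (b : EuclideanSpace ℝ (Fin d) → ℝ)) :=
    hb.continuous_fderiv (by norm_num)
  obtain ⟨C, hC⟩ := hc.bounded_above_of_compact_support (b.hasCompactSupport.fderiv ℝ)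
  have hC0 : 0 ≤ C := (norm_nonneg _).trans (hC 0)
  refine ⟨C + 1, by positivity, fun R hR => ?_⟩
  have hR0 : 0 < R := by linarith
  have hcd : ContDiff ℝ 1 (fun x => b (R⁻¹ • (x - o))) := hb.comp (by fun_prop)
  have hz : ∀ x, x ∉ Metric.ball o (2 * R) → b (R⁻¹ • (x - o)) = 0 := by
    intro x hx
    have h2 : (R⁻¹ • (x - o)) ∉ Function.support b := by
      rw [b.support_eq]
      simp only [Metric.mem_ball, not_lt, dist_eq_norm, sub_zero, norm_smul, norm_inv,
        Real.norm_eq_abs, abs_of_pos hR0] at hx ⊢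
      change 2 ≤ _
      rw [inv_mul_eq_div, le_div_iff₀ hR0]
      exact hx
    simpa using h2
  refine ⟨fun x => b (R⁻¹ • (x - o)), hcd, fun x => b.nonneg, fun x => b.le_one, ?_, hz, ?_, ?_⟩
  · intro x hx
    apply b.one_of_mem_closedBall
    simp only [Metric.mem_ball, dist_eq_norm, Metric.mem_closedBall, sub_zero, norm_smul, norm_inv,
        Real.norm_eq_abs, abs_of_pos hR0] at hx ⊢
    change _ ≤ 1
    rw [inv_mul_eq_div, div_le_one hR0]
    linarith
  · refine HasCompactSupport.intro (isCompact_closedBall o (2 * R)) fun x hx => hz x ?_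
    exact fun h => hx (Metric.ball_subset_closedBall h)
  · intro i x
    have h1 : HasFDerivAt (fun x => b (R⁻¹ • (x - o)))
        ((fderiv ℝ b (R⁻¹ • (x - o))).comp (R⁻¹ • ContinuousLinearMap.id ℝ _)) x := by
      have hA : HasFDerivAt (b : EuclideanSpace ℝ (Fin d) → ℝ) (fderiv ℝ b (R⁻¹ • (x - o)))
          (R⁻¹ • (x - o)) := ((hb.differentiable (by norm_num)) _).hasFDerivAt
      have hB : HasFDerivAt (fun x : EuclideanSpace ℝ (Fin d) => R⁻¹ • (x - o))
          (R⁻¹ • ContinuousLinearMap.id ℝ (EuclideanSpace ℝ (Fin d))) x :=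
        ((hasFDerivAt_id x).sub_const o).const_smul R⁻¹
      exact HasFDerivAt.comp (g := (b : EuclideanSpace ℝ (Fin d) → ℝ)) x hA hB
    unfold pd
    rw [h1.fderiv]
    simp only [ContinuousLinearMap.comp_smul, ContinuousLinearMap.comp_id,
      smul_apply, smul_eq_mul, abs_mul, abs_inv, abs_of_pos hR0]
    rw [inv_mul_eq_div]
    gcongr
    calc _ ≤ ‖fderiv ℝ b (R⁻¹ • (x - o))‖ * ‖EuclideanSpace.single i (1:ℝ)‖ :=
          (fderiv ℝ b (R⁻¹ • (x - o))).le_opNorm _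
      _ ≤ C * 1 := by gcongr; exact hC _; simp
      _ ≤ C + 1 := by linarith

/-- Elementary Young inequality. -/
lemma young_aux {A c κ : ℝ} (hA : 0 ≤ A) (hc : 0 < c) (hκ : 1 < κ) :
    c * A ^ (1 - 1 / κ) ≤ A / 2 + (2 * c) ^ κ := by
  have hκ0 : 0 < κ := by linarith
  have e0 : 0 < 1 - 1 / κ := by
    rw [sub_pos, div_lt_one hκ0]; exact hκ
  rcases hA.eq_or_lt with rfl | hA
  · rw [Real.zero_rpow e0.ne']; simp; positivity
  rcases le_total (2 * c) (A ^ (1 / κ)) with h | h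
  · have : A = A ^ (1 / κ) * A ^ (1 - 1 / κ) := by
      rw [← Real.rpow_add hA]; simp
    have h2 : 0 ≤ A ^ (1 - 1 / κ) := by positivity
    have h3 : 0 ≤ (2 * c) ^ κ := by positivity
    nlinarith [mul_le_mul_of_nonneg_right h h2]
  · have h1 : A ≤ (2 * c) ^ κ := by
      have := Real.rpow_le_rpow (by positivity) h hκ0.le
      rwa [← Real.rpow_mul hA.le, one_div, inv_mul_cancel₀ hκ0.ne', Real.rpow_one] at this
    have h2 : A ^ (1 - 1 / κ) ≤ (2 * c) ^ (κ - 1) := by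
      have := Real.rpow_le_rpow hA.le h1 e0.le
      rwa [← Real.rpow_mul (by positivity), show κ * (1 - 1 / κ) = κ - 1 by field_simp] at this
    have h3 : (2 * c) ^ κ = (2 * c) * (2 * c) ^ (κ - 1) := by
      rw [Real.rpow_sub_one (by positivity)]; field_simp
    have h4 : 0 ≤ (2 * c) ^ (κ - 1) := by positivity
    nlinarith [mul_le_mul_of_nonneg_left h2 hc.le]

/-- Core: no vector field with positive weighted divergence of superlinear type. -/
lemma core {d : ℕ} {f : EuclideanSpace ℝ (Fin d) → ℝ} (hf : ContDiff ℝ 2 f)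
    (o : EuclideanSpace ℝ (Fin d)) (C : ℝ) (hC : 0 < C) (hvol : ∀ R : ℝ, 1 ≤ R →
        (∫ x in Metric.ball o R, Real.exp (-f x)) ≤ C * R ^ d)
    (V : Fin d → EuclideanSpace ℝ (Fin d) → ℝ) (hV : ∀ i, ContDiff ℝ 1 (V i))
    (P : EuclideanSpace ℝ (Fin d) → ℝ)
    (hP : ∀ x, P x = ∑ i, (pd i (V i) x - pd i f x * V i x))
    (hpos : ∀ x, 0 < P x) (κ K : ℝ) (hK : 0 ≤ K) (hκ : 1 < κ) (hκd : (d : ℝ) < κ)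
    (hb : ∀ i x, |V i x| ≤ K * P x ^ (1 - 1 / κ)) : False := by
  have hκ0 : 0 < κ := by linarith
  obtain ⟨M, hM, hcut⟩ := exists_cutoff o
  have hfc := hf.continuous
  have hPc : Continuous P := by
    have : P = fun x => ∑ i, (pd i (V i) x - pd i f x * V i x) := funext hP
    rw [this]
    refine continuous_finsetSum _ fun i _ => ?_
    have h1 := (pd_contDiff (m := 0) i (hV i) (by norm_num)).continuous
    have h2 := (pd_contDiff (m := 1) i hf (by norm_num)).continuous
    have h3 := (hV i).continuous
    fun_prop
  obtain ⟨m, hm⟩ := exists_nat_gt κ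
  have hm0 : 0 < (m : ℝ) := by linarith
  have hm1 : 1 ≤ m := by exact_mod_cast hm0
  set c : ℝ := (d * (m * M * K)) + 1 with hc
  have hcpos : 0 < c := by positivity
  -- mass in the unit ball
  have Iloc : ∀ r : ℝ, ∀ g : EuclideanSpace ℝ (Fin d) → ℝ, Continuous g →
      IntegrableOn g (Metric.ball o r) := fun r g hg =>
    (hg.continuousOn.integrableOn_compact (isCompact_closedBall o r)).mono_set
      Metric.ball_subset_closedBall
  set m0 : ℝ := ∫ x in Metric.ball o 1, P x * Real.exp (-f x) with hm0'
  have hm0pos : 0 < m0 := by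
    rw [hm0', setIntegral_pos_iff_support_of_nonneg_ae]
    · have : Function.support (fun x => P x * Real.exp (-f x)) = Set.univ := by
        ext x
        simp [(hpos x).ne', (Real.exp_pos (-f x)).ne']
      rw [this, Set.univ_inter]
      exact Metric.measure_ball_pos _ _ one_pos
    · exact Eventually.of_forall fun x => mul_nonneg (hpos x).le (Real.exp_pos _).le
    · exact Iloc 1 _ (by fun_prop)
  have main : ∀ R : ℝ, 1 ≤ R → m0 / 2 ≤ (2 * c) ^ κ * (C * 2 ^ d) * R ^ (d - κ) := by
    intro R hR
    have hR0 : 0 < R := by linarith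
    obtain ⟨φ, hφ, hφ0, hφ1, hφb, hφz, hφs, hφd⟩ := hcut R hR
    obtain ⟨hI, hzero⟩ := div_thm hf (fun i x => φ x ^ m * V i x)
      (fun i => (hφ.pow m).mul (hV i))
      (fun i => by
        refine HasCompactSupport.mul_right ?_
        exact HasCompactSupport.comp_left (g := fun t : ℝ => t ^ m) hφs (by simp; omega))
    have hφdiff := hφ.differentiable (by norm_num)
    have hexpand : ∀ x, ∑ i, (pd i (fun x => φ x ^ m * V i x) x - pd i f x * (φ x ^ m * V i x))
        = φ x ^ m * P x + ∑ i, m * φ x ^ (m - 1) * pd i φ x * V i x := by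
      intro x
      rw [hP, Finset.mul_sum, ← Finset.sum_add_distrib]
      refine Finset.sum_congr rfl fun i _ => ?_
      have hVd := (hV i).differentiable (by norm_num)
      have hl : HasLineDerivAt ℝ (fun x => φ x ^ m * V i x)
          ((m * φ x ^ (m - 1) * pd i φ x) * V i x + φ x ^ m * pd i (V i) x) x
          (EuclideanSpace.single i 1) :=
        ld_mul (ld_pow (pd_line i (hφdiff x)) m) (pd_line i (hVd x))
      have hdd : DifferentiableAt ℝ (fun x => φ x ^ m * V i x) x :=
        ((hφdiff x).pow m).mul (hVd x)
      rw [pd_eq hdd hl]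
      ring
    have hge : ∀ x, φ x ^ m * P x / 2 - (Metric.ball o (2 * R)).indicator
        (fun _ => (2 * (c / R)) ^ κ) x ≤
        ∑ i, (pd i (fun x => φ x ^ m * V i x) x - pd i f x * (φ x ^ m * V i x)) := by
      intro x
      rw [hexpand]
      have hPx := hpos x
      have hbd : |∑ i, m * φ x ^ (m - 1) * pd i φ x * V i x|
          ≤ c / R * (φ x ^ (m - 1) * P x ^ (1 - 1 / κ)) := by
        have hX : 0 ≤ φ x ^ (m - 1) * P x ^ (1 - 1 / κ) :=
          mul_nonneg (pow_nonneg (hφ0 x) _) (by positivity)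
        calc _ ≤ ∑ i : Fin d, |m * φ x ^ (m - 1) * pd i φ x * V i x| :=
              Finset.abs_sum_le_sum_abs _ _
          _ ≤ ∑ i : Fin d, m * φ x ^ (m - 1) * (M / R) * (K * P x ^ (1 - 1 / κ)) := by
              refine Finset.sum_le_sum fun i _ => ?_
              rw [abs_mul, abs_mul, abs_of_nonneg (mul_nonneg hm0.le (pow_nonneg (hφ0 x) _))]
              have := pow_nonneg (hφ0 x) (m - 1)
              gcongr
              · exact hφd i x
              · exact hb i x
          _ = (d * (m * M * K)) / R * (φ x ^ (m - 1) * P x ^ (1 - 1 / κ)) := by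
              simp only [Finset.sum_const, Finset.card_univ, Fintype.card_fin, nsmul_eq_mul]
              ring
          _ ≤ _ := by
              refine mul_le_mul_of_nonneg_right ?_ hX
              gcongr
              rw [hc]; linarith
      by_cases hx : x ∈ Metric.ball o (2 * R)
      · rw [Set.indicator_of_mem hx]
        have hpw : φ x ^ (m - 1) * P x ^ (1 - 1 / κ) ≤ (φ x ^ m * P x) ^ (1 - 1 / κ) := by
          rw [Real.mul_rpow (pow_nonneg (hφ0 x) _) hPx.le]
          refine mul_le_mul_of_nonneg_right ?_ (by positivity)
          rcases (hφ0 x).eq_or_lt with h0 | h0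
          · rw [← h0, zero_pow (by
              have : (1:ℝ) < m := by linarith
              have : 1 < m := by exact_mod_cast this
              omega)]
            exact Real.rpow_nonneg (pow_nonneg le_rfl _) _
          · rw [← Real.rpow_natCast, ← Real.rpow_natCast, ← Real.rpow_mul h0.le]
            apply Real.rpow_le_rpow_of_exponent_ge h0 (hφ1 x)
            rw [Nat.cast_sub hm1, mul_sub, mul_one, Nat.cast_one, mul_one_div]
            have : 1 ≤ (m : ℝ) / κ := by rw [one_le_div hκ0]; exact hm.le
            linarith
        have hy := young_aux (A := φ x ^ m * P x) (c := c / R)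
          (mul_nonneg (pow_nonneg (hφ0 x) _) hPx.le) (by positivity) hκ
        have := (abs_le.mp hbd).1
        have h5 : c / R * (φ x ^ (m - 1) * P x ^ (1 - 1 / κ)) ≤
          c / R * (φ x ^ m * P x) ^ (1 - 1 / κ) := by gcongr
        linarith
      · have h0 := hφz x hx
        rw [Set.indicator_of_notMem hx, h0] 
        have hmm : m - 1 ≠ 0 := by
          have : (1:ℝ) < m := by linarith
          have : 1 < m := by exact_mod_cast this
          omega
        simp [zero_pow hmm, zero_pow (show m ≠ 0 by omega)]
    -- integrate
    have hi1 : Integrable (fun x => φ x ^ m * P x / 2 * Real.exp (-f x)) := by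
      have hφc := hφ.continuous
      refine Continuous.integrable_of_hasCompactSupport (by fun_prop) ?_
      have h1 : HasCompactSupport (fun x => φ x ^ m) :=
        HasCompactSupport.comp_left (g := fun t : ℝ => t ^ m) hφs (by simp; omega)
      have : (fun x => φ x ^ m * P x / 2 * Real.exp (-f x))
        = fun x => φ x ^ m * (P x / 2 * Real.exp (-f x)) := by funext x; ring
      rw [this]
      exact h1.mul_right
    have hi2' : IntegrableOn (fun x => (2 * (c / R)) ^ κ * Real.exp (-f x))
        (Metric.ball o (2 * R)) := Iloc _ _ (by fun_prop)
    have e2 : (fun x => (Metric.ball o (2 * R)).indicator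
        (fun _ => (2 * (c / R)) ^ κ) x * Real.exp (-f x)) = (Metric.ball o (2 * R)).indicator
          (fun x => (2 * (c / R)) ^ κ * Real.exp (-f x)) := by
      funext x
      by_cases hx : x ∈ Metric.ball o (2 * R)
      · simp only [Set.indicator_of_mem hx]
      · simp only [Set.indicator_of_notMem hx, zero_mul]
    have hi2 : Integrable (fun x => (Metric.ball o (2 * R)).indicator
        (fun _ => (2 * (c / R)) ^ κ) x * Real.exp (-f x)) := by
      rw [e2]
      exact hi2'.integrable_indicator Metric.isOpen_ball.measurableSet
    have hle : ∫ x, (φ x ^ m * P x / 2 * Real.exp (-f x) - (Metric.ball o (2 * R)).indicator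
        (fun _ => (2 * (c / R)) ^ κ) x * Real.exp (-f x)) ≤ 0 := by
      rw [← hzero]
      refine integral_mono (hi1.sub hi2) hI fun x => ?_
      have := mul_le_mul_of_nonneg_right (hge x) (Real.exp_pos (-f x)).le
      simp only [sub_mul] at this ⊢
      simpa [sub_mul] using this
    rw [integral_sub hi1 hi2, e2, integral_indicator Metric.isOpen_ball.measurableSet,
      integral_const_mul] at hle
    have hlow : m0 / 2 ≤ ∫ x, φ x ^ m * P x / 2 * Real.exp (-f x) := by
      have h1 : ∫ x in Metric.ball o 1, φ x ^ m * P x / 2 * Real.exp (-f x) = m0 / 2 := by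
        rw [hm0', ← integral_div]
        refine setIntegral_congr_fun Metric.isOpen_ball.measurableSet fun x hx => ?_
        simp only [hφb x hx]
        ring
      rw [← h1]
      refine setIntegral_le_integral hi1 (Eventually.of_forall fun x => ?_)
      have := pow_nonneg (hφ0 x) m
      have := hpos x
      simp only [Pi.zero_apply]
      positivity
    have hup := hvol (2 * R) (by linarith)
    have h6 : (2 * (c / R)) ^ κ * (∫ x in Metric.ball o (2 * R), Real.exp (-f x)) ≤
        (2 * (c / R)) ^ κ * (C * (2 * R) ^ d) := by gcongr
    have h7 : (2 * (c / R)) ^ κ * (C * (2 * R) ^ d) =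
        (2 * c) ^ κ * (C * 2 ^ d) * R ^ (d - κ) := by
      rw [← mul_div_assoc, Real.div_rpow (by positivity) hR0.le, Real.rpow_sub hR0,
        Real.rpow_natCast, mul_pow]
      field_simp
    linarith
  have hlim : Tendsto (fun R : ℝ => (2 * c) ^ κ * (C * 2 ^ d) * R ^ (d - κ)) atTop
      (nhds ((2 * c) ^ κ * (C * 2 ^ d) * 0)) := by
    refine Tendsto.const_mul _ ?_
    have := tendsto_rpow_neg_atTop (y := κ - d) (by linarith)
    simpa using this
  rw [mul_zero] at hlim
  have := ge_of_tendsto hlim (eventually_atTop.2 ⟨1, fun R hR => main R hR⟩)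
  linarith


lemma second_test {d : ℕ} {g : EuclideanSpace ℝ (Fin d) → ℝ} (hg : ContDiff ℝ 2 g)
    {x : EuclideanSpace ℝ (Fin d)} (hx : IsLocalMin g x) (i : Fin d) : 0 ≤ pd i (pd i g) x := by
  by_contra hneg
  push Not at hneg
  set e : EuclideanSpace ℝ (Fin d) := EuclideanSpace.single i 1
  set G : ℝ → ℝ := fun t => g (x + t • e) with hG
  have hline : ∀ (k : EuclideanSpace ℝ (Fin d) → ℝ), Differentiable ℝ k → ∀ t : ℝ,
      HasDerivAt (fun t : ℝ => k (x + t • e)) (pd i k (x + t • e)) t := by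
    intro k hk t
    have h1 : HasDerivAt (fun t : ℝ => x + t • e) e t := by
      have := ((hasDerivAt_id t).smul_const e).const_add x
      simpa using this
    exact (hk (x + t • e)).hasFDerivAt.comp_hasDerivAt t h1
  have hd1 : deriv G = fun t => pd i g (x + t • e) := by
    funext t
    exact (hline g (hg.differentiable (by norm_num)) t).deriv
  have hd2 : deriv (deriv G) 0 = pd i (pd i g) x := by
    rw [hd1]
    have := (hline (pd i g) ((pd_contDiff (m := 1) i hg (by norm_num)).differentiable
      (by norm_num)) 0).deriv
    simpa using this
  have hGc : ContinuousAt G 0 := by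
    have := hg.continuous
    exact Continuous.continuousAt (by fun_prop)
  have hmin : IsLocalMin G 0 := by
    have hcont : ContinuousAt (fun t : ℝ => x + t • e) 0 := by fun_prop
    have h0 : (fun t : ℝ => x + t • e) 0 = x := by simp
    have : Tendsto (fun t : ℝ => x + t • e) (nhds 0) (nhds x) := by
      have := hcont.tendsto
      simpa using this
    have h2 := this.eventually hx
    filter_upwards [h2] with t ht
    simpa [hG] using ht
  have hmax : IsLocalMax G 0 :=
    isLocalMax_of_deriv_deriv_neg (by rw [hd2]; exact hneg) hmin.deriv_eq_zero hGc
  have hconst : G =ᶠ[nhds 0] fun _ => G 0 := by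
    filter_upwards [hmin, hmax] with t h1 h2
    exact le_antisymm h2 h1
  have := hconst.deriv.deriv_eq
  rw [hd2] at this
  simp at this
  linarith

lemma ld_normsq {d : ℕ} (i : Fin d) (x y : EuclideanSpace ℝ (Fin d)) :
    HasLineDerivAt ℝ (fun z : EuclideanSpace ℝ (Fin d) => ‖z - y‖ ^ 2) (2 * (x i - y i)) x
      (EuclideanSpace.single i 1) := by
  have h : HasFDerivAt (fun z : EuclideanSpace ℝ (Fin d) => ‖z - y‖ ^ 2)
      (2 • (innerSL ℝ (x - y)).comp (ContinuousLinearMap.id ℝ _)) x :=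
    ((hasFDerivAt_id x).sub_const y).norm_sq
  have := h.hasLineDerivAt (EuclideanSpace.single i 1)
  have e : (2 • (innerSL ℝ (x - y)).comp (ContinuousLinearMap.id ℝ _))
      (EuclideanSpace.single i 1) = 2 * (x i - y i) := by
    simp only [ContinuousLinearMap.comp_id, smul_apply, nsmul_eq_mul, Nat.cast_ofNat]
    rw [innerSL_apply_apply, EuclideanSpace.inner_single_right]
    simp
  rw [e] at this
  exact this

lemma barrier {d : ℕ} (α : ℝ) (y : EuclideanSpace ℝ (Fin d)) (i : Fin d)
    (x : EuclideanSpace ℝ (Fin d)) :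
    pd i (pd i (fun z => Real.exp (-α * ‖z - y‖ ^ 2))) x =
      (4 * α ^ 2 * (x i - y i) ^ 2 - 2 * α) * Real.exp (-α * ‖x - y‖ ^ 2) := by
  have hsm : ContDiff ℝ 2 (fun z : EuclideanSpace ℝ (Fin d) => Real.exp (-α * ‖z - y‖ ^ 2)) := by
    have : ContDiff ℝ 2 (fun z : EuclideanSpace ℝ (Fin d) => ‖z - y‖ ^ 2) :=
      (contDiff_id.sub contDiff_const).norm_sq ℝ
    exact (contDiff_const.mul this).exp
  have hE : ∀ x, HasLineDerivAt ℝ (fun z : EuclideanSpace ℝ (Fin d) => Real.exp (-α * ‖z - y‖ ^ 2))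
      (Real.exp (-α * ‖x - y‖ ^ 2) * (-α * (2 * (x i - y i)))) x (EuclideanSpace.single i 1) := by
    intro x
    have := HasDerivAt.exp (ld_const_mul (-α) (ld_normsq i x y))
    simp only [zero_smul, add_zero] at this
    exact this
  have h1 : pd i (fun z => Real.exp (-α * ‖z - y‖ ^ 2)) = fun x =>
      (Real.exp (-α * ‖x - y‖ ^ 2) * (-α * (2 * (x i - y i)))) := by
    funext x
    exact pd_eq (hsm.differentiable (by norm_num) x) (hE x)
  have hc : HasLineDerivAt ℝ (fun z : EuclideanSpace ℝ (Fin d) => -α * (2 * (z i - y i)))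
      (-α * (2 * 1)) x (EuclideanSpace.single i 1) := by
    refine ld_const_mul _ (ld_const_mul _ ?_)
    have : HasDerivAt (fun t : ℝ => (x i + t) - y i) 1 0 :=
      ((hasDerivAt_id (0:ℝ)).const_add (x i)).sub_const (y i)
    unfold HasLineDerivAt
    simpa using this
  have hd : DifferentiableAt ℝ (pd i (fun z => Real.exp (-α * ‖z - y‖ ^ 2))) x :=
    ((pd_contDiff (m := 1) i hsm (by norm_num)).differentiable (by norm_num)) x
  rw [h1] at hd ⊢
  rw [pd_eq hd (ld_mul (hE x) hc)]
  ring

lemma pd_sub_const_mul {d : ℕ} (i : Fin d) {u h : EuclideanSpace ℝ (Fin d) → ℝ}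
    (hu : ContDiff ℝ 2 u) (hh : ContDiff ℝ 2 h) (m c : ℝ) (x : EuclideanSpace ℝ (Fin d)) :
    pd i (pd i (fun z => u z - m * (h z - c))) x = pd i (pd i u) x - m * pd i (pd i h) x := by
  have e1 : pd i (fun z => u z - m * (h z - c)) = fun z => pd i u z - m * pd i h z := by
    funext z
    have h1 := hu.differentiable (by norm_num) z
    have h2 := hh.differentiable (by norm_num) z
    unfold pd
    rw [fderiv_fun_sub h1 ((h2.sub_const c).const_mul m), fderiv_const_mul (h2.sub_const c),
      fderiv_sub_const]
    simp
  rw [e1]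
  have h1 := (pd_contDiff (m := 1) i hu (by norm_num)).differentiable (by norm_num) x
  have h2 := (pd_contDiff (m := 1) i hh (by norm_num)).differentiable (by norm_num) x
  show fderiv ℝ _ x _ = fderiv ℝ _ x _ - m * fderiv ℝ _ x _
  rw [fderiv_fun_sub h1 (h2.const_mul m), fderiv_const_mul h2]
  simp

lemma strong_max {d : ℕ} {u : EuclideanSpace ℝ (Fin d) → ℝ} (hu : ContDiff ℝ 2 u)
    (h0 : ∀ x, 0 ≤ u x) (hsup : ∀ x, ∑ i, pd i (pd i u) x ≤ 0)
    {x₀ : EuclideanSpace ℝ (Fin d)} (hx₀ : u x₀ = 0) : ∀ x, u x = 0 := by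
  by_contra hcon
  push Not at hcon
  obtain ⟨y, hy⟩ := hcon
  have huc := hu.continuous
  set Z : Set (EuclideanSpace ℝ (Fin d)) := {x | u x = 0} with hZ
  have hZc : IsClosed Z := isClosed_eq huc continuous_const
  obtain ⟨z, hzZ, hzd⟩ := hZc.exists_infDist_eq_dist ⟨x₀, hx₀⟩ y
  have hzne : y ≠ z := fun h => hy (h ▸ hzZ)
  set r := dist y z with hr
  have hr0 : 0 < r := dist_pos.mpr hzne
  have hin : ∀ x, dist y x < r → 0 < u x := by
    intro x hx
    refine lt_of_le_of_ne (h0 x) fun h => ?_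
    have : Metric.infDist y Z ≤ dist y x := Metric.infDist_le_dist_of_mem (by exact h.symm)
    linarith
  obtain ⟨q, hq, hqmin⟩ := (isCompact_closedBall y (r / 2)).exists_isMinOn
    ⟨y, Metric.mem_closedBall_self (by positivity)⟩ huc.continuousOn
  set m := u q with hm
  have hmpos : 0 < m := hin q (by
    rw [dist_comm]; have := Metric.mem_closedBall.mp hq; linarith)
  set α : ℝ := (2 * d + 1) / r ^ 2 with hα
  have hαr : α * r ^ 2 = 2 * d + 1 := by rw [hα]; field_simp
  have hα0 : 0 < α := by positivity
  set h : EuclideanSpace ℝ (Fin d) → ℝ := fun z => Real.exp (-α * ‖z - y‖ ^ 2) with hh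
  have hsm : ContDiff ℝ 2 h := by
    have : ContDiff ℝ 2 (fun z : EuclideanSpace ℝ (Fin d) => ‖z - y‖ ^ 2) :=
      (contDiff_id.sub contDiff_const).norm_sq ℝ
    exact (contDiff_const.mul this).exp
  set c := Real.exp (-α * r ^ 2) with hc
  have hcpos : 0 < c := Real.exp_pos _
  set w : EuclideanSpace ℝ (Fin d) → ℝ := fun z => u z - m * (h z - c) with hw
  have hwsm : ContDiff ℝ 2 w := hu.sub (contDiff_const.mul (hsm.sub contDiff_const))
  set K := Metric.closedBall y r \ Metric.ball y (r / 2) with hKdef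
  have hK : IsCompact K := (isCompact_closedBall y r).diff Metric.isOpen_ball
  have hzK : z ∈ K := by
    constructor
    · rw [Metric.mem_closedBall, dist_comm]
    · rw [Metric.mem_ball, dist_comm]; linarith
  obtain ⟨s, hsK, hsmin⟩ := hK.exists_isMinOn ⟨z, hzK⟩ hwsm.continuous.continuousOn
  have hws : 0 ≤ w s := by
    by_contra hneg
    push Not at hneg
    have hs1 : dist s y ≤ r := hsK.1
    have hs2 : r / 2 ≤ dist s y := by
      have := hsK.2
      rw [Metric.mem_ball] at this
      linarith
    have hne1 : dist s y ≠ r := by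
      intro he
      have : h s = c := by
        simp only [hh, hc]; rw [← dist_eq_norm, he]
      have : w s = u s := by simp only [hw, this]; ring
      linarith [h0 s]
    have hne2 : dist s y ≠ r / 2 := by
      intro he
      have h1 : m ≤ u s := hqmin (Metric.mem_closedBall.mpr he.le)
      have h2 : h s ≤ 1 := Real.exp_le_one_iff.mpr (by
        have := sq_nonneg ‖s - y‖
        nlinarith)
      have : w s = u s - m * (h s - c) := rfl
      nlinarith
    have hloc : IsLocalMin w s := by
      have hopen : IsOpen (Metric.ball y r \ Metric.closedBall y (r / 2)) :=
        Metric.isOpen_ball.sdiff Metric.isClosed_closedBall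
      have hmem : s ∈ Metric.ball y r \ Metric.closedBall y (r / 2) := by
        refine ⟨lt_of_le_of_ne hs1 hne1, ?_⟩
        rw [Metric.mem_closedBall]
        push Not
        exact lt_of_le_of_ne hs2 (Ne.symm hne2)
      filter_upwards [hopen.mem_nhds hmem] with p hp
      refine hsmin ⟨Metric.ball_subset_closedBall hp.1, fun h => hp.2 ?_⟩
      exact Metric.ball_subset_closedBall h
    have hsum : 0 ≤ ∑ i, pd i (pd i w) s := Finset.sum_nonneg fun i _ => second_test hwsm hloc i
    have e : ∑ i, pd i (pd i w) s = ∑ i, pd i (pd i u) s - m *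
        ((4 * α ^ 2 * ‖s - y‖ ^ 2 - 2 * α * d) * h s) := by
      have : ∀ i, pd i (pd i w) s = pd i (pd i u) s - m *
          ((4 * α ^ 2 * (s i - y i) ^ 2 - 2 * α) * h s) := by
        intro i
        rw [hw, pd_sub_const_mul i hu hsm, hh, barrier]
      simp only [this]
      rw [Finset.sum_sub_distrib, ← Finset.mul_sum, ← Finset.sum_mul, Finset.sum_sub_distrib,
        ← Finset.mul_sum, EuclideanSpace.norm_sq_eq]
      simp only [PiLp.sub_apply, Real.norm_eq_abs, sq_abs, Finset.sum_const, Finset.card_univ,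
        Fintype.card_fin, nsmul_eq_mul]
      ring
    have hpos : 0 < (4 * α ^ 2 * ‖s - y‖ ^ 2 - 2 * α * d) * h s := by
      refine mul_pos ?_ (Real.exp_pos _)
      rw [← dist_eq_norm]
      have h1 : (r / 2) ^ 2 ≤ dist s y ^ 2 := by gcongr
      have h2 : 4 * α ^ 2 * (r / 2) ^ 2 ≤ 4 * α ^ 2 * dist s y ^ 2 := by gcongr
      have h3 : 4 * α ^ 2 * (r / 2) ^ 2 = α * (2 * d + 1) := by rw [← hαr]; ring
      nlinarith
    have := hsup s
    have := mul_pos hmpos hpos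
    linarith
  -- directional derivative at z
  set Q : ℝ → ℝ := fun t => u (z + t • (y - z)) -
    m * (Real.exp (-α * ((1 - t) ^ 2 * r ^ 2)) - c) with hQ
  have hzloc : IsLocalMin u z := Eventually.of_forall fun p => by
    have : u z = 0 := hzZ
    rw [this]; exact h0 p
  have hQd : HasDerivAt Q (0 - m * (c * (2 * α * r ^ 2))) 0 := by
    refine HasDerivAt.sub ?_ ?_
    · have h1 : HasFDerivAt u (0 : EuclideanSpace ℝ (Fin d) →L[ℝ] ℝ) z := by
        rw [← hzloc.fderiv_eq_zero]
        exact (hu.differentiable (by norm_num) z).hasFDerivAt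
      have := h1.hasLineDerivAt (y - z)
      simpa [HasLineDerivAt] using this
    · refine HasDerivAt.const_mul m (HasDerivAt.sub_const c ?_)
      have h1 : HasDerivAt (fun t : ℝ => -α * ((1 - t) ^ 2 * r ^ 2)) (2 * α * r ^ 2) 0 := by
        have := ((((hasDerivAt_id (0:ℝ)).const_sub 1).pow 2).mul_const (r ^ 2)).const_mul (-α)
        refine this.congr_deriv ?_
        simp
        ring
      have := h1.exp
      simpa [hc] using this
  have hQ0 : Q 0 = 0 := by
    have : u z = 0 := hzZ
    simp [hQ, this, hc]
  have hQnn : ∀ t : ℝ, 0 < t → t < 1 / 2 → 0 ≤ Q t := by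
    intro t ht ht2
    have hn : ‖z + t • (y - z) - y‖ = (1 - t) * r := by
      have : z + t • (y - z) - y = (1 - t) • (z - y) := by module
      rw [this, norm_smul, Real.norm_eq_abs, abs_of_pos (by linarith), ← dist_eq_norm, dist_comm]
    have hmem : z + t • (y - z) ∈ K := by
      refine ⟨?_, ?_⟩
      · rw [Metric.mem_closedBall, dist_eq_norm, hn]; nlinarith
      · rw [Metric.mem_ball, dist_eq_norm, hn]; push Not; nlinarith
    have h1 := hws.trans (hsmin hmem)
    have h2 : w (z + t • (y - z)) = Q t := by
      simp only [hw, hQ, hh, hn, mul_pow]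
    rw [← h2]; exact h1
  have hslope := hQd.tendsto_slope_zero_right
  have hge : 0 ≤ 0 - m * (c * (2 * α * r ^ 2)) := by
    refine ge_of_tendsto hslope ?_
    have : Set.Ioo (0:ℝ) (1 / 2) ∈ nhdsWithin (0:ℝ) (Set.Ioi 0) :=
      Ioo_mem_nhdsGT (by norm_num)
    filter_upwards [this] with t ht
    have := hQnn t ht.1 ht.2
    rw [zero_add, hQ0, sub_zero, smul_eq_mul]
    exact mul_nonneg (inv_nonneg.mpr ht.1.le) this
  have : 0 < m * (c * (2 * α * r ^ 2)) := by positivity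
  linarith


lemma expo_aux {U Q κ θ σ b δ P C X : ℝ} (hU : 0 < U) (hQ : 0 < Q) (hUQ : U ^ σ ≤ Q)
    (hθ : 0 ≤ 1 - 1 / κ - θ) (hex : 1 / 2 + b / κ = σ * (1 - 1 / κ - θ))
    (hκ : 1 < κ)
    (hδ : 0 < δ) (hP : δ * (U ^ b * Q) ≤ P) (hC : 0 ≤ C) (hX : X ≤ C * (U ^ (b + 1 / 2) * Q ^ θ)) :
    X ≤ (C * δ ^ (-(1 - 1 / κ))) * P ^ (1 - 1 / κ) := by
  have e0 : 0 < 1 - 1 / κ := by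
    rw [sub_pos, div_lt_one (by linarith)]; exact hκ
  have h1 : U ^ (1 / 2 + b / κ) ≤ Q ^ (1 - 1 / κ - θ) := by
    rw [hex, Real.rpow_mul hU.le]
    exact Real.rpow_le_rpow (by positivity) hUQ hθ
  have h2 : U ^ (b + 1 / 2) * Q ^ θ ≤ (U ^ b * Q) ^ (1 - 1 / κ) := by
    rw [Real.mul_rpow (by positivity) hQ.le, ← Real.rpow_mul hU.le]
    have a1 : U ^ (b + 1 / 2) = U ^ (b * (1 - 1 / κ)) * U ^ (1 / 2 + b / κ) := by
      rw [← Real.rpow_add hU]; congr 1; ring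
    have a2 : Q ^ (1 - 1 / κ) = Q ^ (1 - 1 / κ - θ) * Q ^ θ := by
      rw [← Real.rpow_add hQ]; congr 1; ring
    rw [a1, a2, mul_assoc]
    gcongr
  have h3 : (U ^ b * Q) ^ (1 - 1 / κ) ≤ δ ^ (-(1 - 1 / κ)) * P ^ (1 - 1 / κ) := by
    have := Real.rpow_le_rpow (by positivity) hP e0.le
    rw [Real.mul_rpow hδ.le (by positivity)] at this
    rw [Real.rpow_neg hδ.le, inv_mul_eq_div, le_div_iff₀ (by positivity)]
    linarith
  calc X ≤ C * (U ^ (b + 1 / 2) * Q ^ θ) := hX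
    _ ≤ C * (δ ^ (-(1 - 1 / κ)) * P ^ (1 - 1 / κ)) := 
        mul_le_mul_of_nonneg_left (h2.trans h3) hC
    _ = _ := by ring

lemma hess_ineq {d : ℕ} (hd : 0 < d) (w : Fin d → ℝ) (H : Fin d → Fin d → ℝ) (s k : ℝ)
    (hs : 0 ≤ s) (hk : 0 ≤ k) (hT : ∑ i, H i i ≤ -s) :
    (s + k * ∑ i, w i * w i) ^ 2 / d + 2 * k * (∑ i, ∑ j, H i j * w i * w j)
      - k ^ 2 * (∑ i, w i * w i) ^ 2 ≤ ∑ i, ∑ j, H i j ^ 2 := by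
  have hd' : (0:ℝ) < d := by exact_mod_cast hd
  set g := ∑ i, w i * w i with hg
  have hg0 : 0 ≤ g := Finset.sum_nonneg fun i _ => mul_self_nonneg _
  have e1 : ∑ i, ∑ j, (H i j - k * (w i * w j)) ^ 2 =
      ∑ i, ∑ j, H i j ^ 2 - 2 * k * (∑ i, ∑ j, H i j * w i * w j) + k ^ 2 * g ^ 2 := by
    have : g ^ 2 = ∑ i, ∑ j, (w i * w j) ^ 2 := by
      rw [hg, sq, Finset.sum_mul_sum]
      refine Finset.sum_congr rfl fun i _ => Finset.sum_congr rfl fun j _ => by ring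
    rw [this]
    simp only [Finset.mul_sum, ← Finset.sum_sub_distrib, ← Finset.sum_add_distrib]
    refine Finset.sum_congr rfl fun i _ => Finset.sum_congr rfl fun j _ => by ring
  have e2 : ∑ i, (H i i - k * (w i * w i)) ^ 2 ≤ ∑ i, ∑ j, (H i j - k * (w i * w j)) ^ 2 := by
    refine Finset.sum_le_sum fun i _ => ?_
    exact Finset.single_le_sum (f := fun j => (H i j - k * (w i * w j)) ^ 2)
      (fun j _ => sq_nonneg _) (Finset.mem_univ i)
  have e3 : (∑ i, (H i i - k * (w i * w i))) ^ 2 ≤ d * ∑ i, (H i i - k * (w i * w i)) ^ 2 := by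
    have := sq_sum_le_card_mul_sum_sq (s := Finset.univ) (f := fun i => H i i - k * (w i * w i))
    simpa using this
  have e4 : ∑ i, (H i i - k * (w i * w i)) = ∑ i, H i i - k * g := by
    rw [Finset.sum_sub_distrib, ← Finset.mul_sum]
  have e5 : (s + k * g) ^ 2 ≤ (∑ i, (H i i - k * (w i * w i))) ^ 2 := by
    rw [e4]
    have : 0 ≤ k * g := by positivity
    nlinarith
  have e6 : (s + k * g) ^ 2 / d ≤ ∑ i, (H i i - k * (w i * w i)) ^ 2 := by
    rw [div_le_iff₀ hd']; linarith
  linarith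

lemma param_aux {D p : ℝ} (hD : 3 ≤ D) (hp : 1 < p) (hps : (D - 2) * p < D + 2) :
    ∃ τ ε : ℝ, 0 < τ ∧ 0 < ε ∧ ε < 1 ∧ τ < 2 ∧ D * (p - 1) < 2 * (2 * p - τ) ∧
      0 < (-(-τ + 2 * (1 - ε) * (τ * D / 2)) / 2) * (-τ - 1)
        - (1 - ε) * (τ * D / 2) ^ 2 * (1 - 1 / D) ∧
      0 < -(-(-τ + 2 * (1 - ε) * (τ * D / 2)) / 2) + 2 * (1 - ε) * (τ * D / 2) / D - p
        + (1 / D - 2 * ε) * (-τ + p) := by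
  have hlow : 2 * p / (D + 2) < min (2 / (D - 2)) (min 2 (2 * p - D * (p - 1) / 2)) := by
    rw [lt_min_iff, lt_min_iff]
    have h2 : 0 < D + 2 := by linarith
    have h3 : 0 < D - 2 := by linarith
    refine ⟨?_, ?_, ?_⟩
    · rw [div_lt_div_iff₀ h2 h3]; nlinarith
    · rw [div_lt_iff₀ h2]; nlinarith
    · rw [div_lt_iff₀ h2]
      by_contra hcon
      push Not at hcon
      nlinarith [mul_lt_mul_of_pos_left hps (show 0 < D by linarith)]
  obtain ⟨τ, hτ1, hτ2⟩ := exists_between hlow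
  rw [lt_min_iff, lt_min_iff] at hτ2
  obtain ⟨ha, hb, hc⟩ := hτ2
  have hτ0 : 0 < τ := lt_trans (by positivity) hτ1
  have h3 : 0 < D - 2 := by linarith
  have h1 : 0 < D - 1 := by linarith
  have hD0 : 0 < D := by linarith
  rw [lt_div_iff₀ h3] at ha
  rw [div_lt_iff₀ (by linarith)] at hτ1
  set A : ℝ → ℝ := fun ε => (-(-τ + 2 * (1 - ε) * (τ * D / 2)) / 2) * (-τ - 1)
        - (1 - ε) * (τ * D / 2) ^ 2 * (1 - 1 / D) with hA
  set B : ℝ → ℝ := fun ε => -(-(-τ + 2 * (1 - ε) * (τ * D / 2)) / 2)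
        + 2 * (1 - ε) * (τ * D / 2) / D - p
        + (1 / D - 2 * ε) * (-τ + p) with hB
  have hA0 : 0 < A 0 := by
    have : A 0 = τ * (D - 1) / 2 * (1 + τ - τ * D / 2) := by
      simp only [hA]; field_simp; ring
    rw [this]
    refine mul_pos (by positivity) (by linarith)
  have hB0 : 0 < B 0 := by
    have : B 0 = (D - 1) / D * (τ * (D + 2) / 2 - p) := by
      simp only [hB]; field_simp; ring
    rw [this]
    refine mul_pos (by positivity) (by linarith)
  have cA : ContinuousAt A 0 := by simp only [hA]; fun_prop
  have cB : ContinuousAt B 0 := by simp only [hB]; fun_prop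
  have ev : ∀ᶠ ε in nhdsWithin (0:ℝ) (Set.Ioi 0), 0 < A ε ∧ 0 < B ε :=
    ((cA.eventually (lt_mem_nhds hA0)).and (cB.eventually (lt_mem_nhds hB0))).filter_mono
      nhdsWithin_le_nhds
  have ev2 : ∀ᶠ ε in nhdsWithin (0:ℝ) (Set.Ioi 0), ε ∈ Set.Ioo (0:ℝ) 1 :=
    Ioo_mem_nhdsGT one_pos
  obtain ⟨ε, ⟨hεA, hεB⟩, hε⟩ := (ev.and ev2).exists
  exact ⟨τ, ε, hτ0, hε.1, hε.2, hb, by linarith, hεA, hεB⟩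

/-- Weighted divergence. -/
noncomputable def dvf {d : ℕ} (f : EuclideanSpace ℝ (Fin d) → ℝ)
    (X : Fin d → EuclideanSpace ℝ (Fin d) → ℝ) (x : EuclideanSpace ℝ (Fin d)) : ℝ :=
  ∑ i, (pd i (X i) x - pd i f x * X i x)

lemma dvf_smul {d : ℕ} (f : EuclideanSpace ℝ (Fin d) → ℝ) (h : EuclideanSpace ℝ (Fin d) → ℝ)
    (X : Fin d → EuclideanSpace ℝ (Fin d) → ℝ) (hh : ContDiff ℝ 1 h)
    (hX : ∀ i, ContDiff ℝ 1 (X i)) (x : EuclideanSpace ℝ (Fin d)) :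
    dvf f (fun i y => h y * X i y) x = ∑ i, pd i h x * X i x + h x * dvf f X x := by
  unfold dvf
  rw [Finset.mul_sum, ← Finset.sum_add_distrib]
  refine Finset.sum_congr rfl fun i _ => ?_
  have h1 := hh.differentiable (by norm_num) x
  have h2 := (hX i).differentiable (by norm_num) x
  have h3 : DifferentiableAt ℝ (fun y => h y * X i y) x := h1.mul h2
  rw [pd_eq h3 (ld_mul (pd_line i h1) (pd_line i h2))]
  ring

lemma dvf_add {d : ℕ} (f : EuclideanSpace ℝ (Fin d) → ℝ)
    (X Y : Fin d → EuclideanSpace ℝ (Fin d) → ℝ) (hX : ∀ i, ContDiff ℝ 1 (X i))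
    (hY : ∀ i, ContDiff ℝ 1 (Y i)) (x : EuclideanSpace ℝ (Fin d)) :
    dvf f (fun i y => X i y + Y i y) x = dvf f X x + dvf f Y x := by
  unfold dvf
  rw [← Finset.sum_add_distrib]
  refine Finset.sum_congr rfl fun i _ => ?_
  have h1 := (hX i).differentiable (by norm_num) x
  have h2 := (hY i).differentiable (by norm_num) x
  have h3 : DifferentiableAt ℝ (fun y => X i y + Y i y) x := h1.add h2
  rw [pd_eq h3 (ld_add (pd_line i h1) (pd_line i h2))]
  ring

lemma dvf_const_mul {d : ℕ} (f : EuclideanSpace ℝ (Fin d) → ℝ) (c : ℝ)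
    (X : Fin d → EuclideanSpace ℝ (Fin d) → ℝ) (hX : ∀ i, ContDiff ℝ 1 (X i))
    (x : EuclideanSpace ℝ (Fin d)) :
    dvf f (fun i y => c * X i y) x = c * dvf f X x := by
  unfold dvf
  rw [Finset.mul_sum]
  refine Finset.sum_congr rfl fun i _ => ?_
  have h2 := (hX i).differentiable (by norm_num) x
  have h3 : DifferentiableAt ℝ (fun y => c * X i y) x := h2.const_mul c
  rw [pd_eq h3 (ld_const_mul c (pd_line i h2))]
  ring

lemma pd_rpow {d : ℕ} {u : EuclideanSpace ℝ (Fin d) → ℝ} (hu : ContDiff ℝ 1 u)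
    (hpos : ∀ x, 0 < u x) (a : ℝ) (i : Fin d) (x : EuclideanSpace ℝ (Fin d)) :
    pd i (fun y => u y ^ a) x = a * u x ^ (a - 1) * pd i u x := by
  have h1 := hu.differentiable (by norm_num) x
  have h3 : DifferentiableAt ℝ (fun y => u y ^ a) x := h1.rpow_const (Or.inl (hpos x).ne')
  exact pd_eq h3 (ld_rpow (pd_line i h1) (hpos x) a)

lemma contDiff_rpow' {d : ℕ} {u : EuclideanSpace ℝ (Fin d) → ℝ} (hu : ContDiff ℝ 1 u)
    (hpos : ∀ x, 0 < u x) (a : ℝ) : ContDiff ℝ 1 (fun y => u y ^ a) :=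
  hu.rpow_const_of_ne fun x => (hpos x).ne'

lemma hess_nonneg {d : ℕ} {f : EuclideanSpace ℝ (Fin d) → ℝ} (hf : ContDiff ℝ 2 f)
    (hconv : ConvexOn ℝ Set.univ f) (x : EuclideanSpace ℝ (Fin d)) (w : Fin d → ℝ) :
    0 ≤ ∑ i, ∑ j, pd i (pd j f) x * w i * w j := by
  set v : EuclideanSpace ℝ (Fin d) := ∑ i, w i • EuclideanSpace.single i (1:ℝ) with hv
  have e : ∑ i, ∑ j, pd i (pd j f) x * w i * w j = fderiv ℝ (fderiv ℝ f) x v v := by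
    rw [hv]
    simp only [map_sum, map_smul, _root_.sum_apply, smul_apply, smul_eq_mul]
    refine Finset.sum_congr rfl fun i _ => ?_
    rw [Finset.mul_sum]
    refine Finset.sum_congr rfl fun j _ => ?_
    rw [pd_comm i j hf, pd_pd j i hf]
    ring
  rw [e]
  set G : ℝ → ℝ := fun t => f (x + t • v) with hG
  have hl : ∀ t : ℝ, HasDerivAt (fun t : ℝ => x + t • v) v t := by
    intro t
    have := ((hasDerivAt_id t).smul_const v).const_add x
    simpa using this
  have hfd := hf.differentiable (by norm_num)
  have hGd : ∀ t, HasDerivAt G (fderiv ℝ f (x + t • v) v) t := fun t =>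
    (hfd (x + t • v)).hasFDerivAt.comp_hasDerivAt t (hl t)
  have hGc : ConvexOn ℝ Set.univ G := by
    refine ⟨convex_univ, fun s _ t _ a b ha hb hab => ?_⟩
    have := hconv.2 (Set.mem_univ (x + s • v)) (Set.mem_univ (x + t • v)) ha hb hab
    have h2 : a • (x + s • v) + b • (x + t • v) = x + (a • s + b • t) • v := by
      have : a • (x + s • v) + b • (x + t • v) = (a + b) • x + (a • s + b • t) • v := by
        simp only [smul_eq_mul]; module
      rw [this, hab, one_smul]
    rw [h2] at this
    exact this
  have hmono : Monotone (deriv G) := by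
    rw [← monotoneOn_univ]
    exact hGc.monotoneOn_deriv fun t _ => (hGd t).differentiableAt
  have hdG : deriv G = fun t => fderiv ℝ f (x + t • v) v := funext fun t => (hGd t).deriv
  have hd2 : HasDerivAt (deriv G) (fderiv ℝ (fderiv ℝ f) x v v) 0 := by
    rw [hdG]
    have h1 : DifferentiableAt ℝ (fderiv ℝ f) (x + (0:ℝ) • v) :=
      ((hf.fderiv_right (m := 1) (by norm_num)).differentiable (by norm_num)) _
    have h2 := h1.hasFDerivAt.comp_hasDerivAt (0:ℝ) (hl 0)
    have h3 := h2.clm_apply (hasDerivAt_const (0:ℝ) v)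
    simpa using h3
  rw [← hd2.deriv]
  exact hmono.deriv_nonneg


section
variable {d : ℕ} {p : ℝ} {f u : EuclideanSpace ℝ (Fin d) → ℝ}

lemma pd_gradsq (hu : ContDiff ℝ 3 u) (i : Fin d) (x : EuclideanSpace ℝ (Fin d)) :
    pd i (fun y => ∑ j, pd j u y * pd j u y) x = 2 * ∑ j, pd i (pd j u) x * pd j u x := by
  have h1 : ∀ j, ContDiff ℝ 1 (pd j u) := fun j =>
    pd_contDiff j hu (by norm_num)
  have hd : ∀ j, DifferentiableAt ℝ (pd j u) x := fun j => (h1 j).differentiable (by norm_num) x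
  have h3 : DifferentiableAt ℝ (fun y => ∑ j, pd j u y * pd j u y) x := by
    have := (ContDiff.sum (s := Finset.univ) fun j _ => (h1 j).mul (h1 j)).differentiable
      (by norm_num) x
    exact this
  rw [pd_eq h3 (ld_sum fun j _ => ld_mul (pd_line i (hd j)) (pd_line i (hd j))), Finset.mul_sum]
  refine Finset.sum_congr rfl fun j _ => by ring

lemma dvf_grad (heq : ∀ x, ∑ i, pd i (pd i u) x - ∑ i, pd i f x * pd i u x + u x ^ p = 0)
    (x : EuclideanSpace ℝ (Fin d)) : dvf f (fun i => pd i u) x = - u x ^ p := by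
  unfold dvf
  rw [Finset.sum_sub_distrib]
  linarith [heq x]

/-- Bochner formula. -/
lemma dvf_hess (hf : ContDiff ℝ 2 f) (hu : ContDiff ℝ 3 u) (hpos : ∀ x, 0 < u x)
    (heq : ∀ x, ∑ i, pd i (pd i u) x - ∑ i, pd i f x * pd i u x + u x ^ p = 0)
    (x : EuclideanSpace ℝ (Fin d)) :
    dvf f (fun i y => ∑ j, pd i (pd j u) y * pd j u y) x =
      ∑ i, ∑ j, pd i (pd j u) x ^ 2 + ∑ i, ∑ j, pd i (pd j f) x * pd i u x * pd j u x
        - p * u x ^ (p - 1) * ∑ i, pd i u x * pd i u x := by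
  have h1 : ∀ j, ContDiff ℝ 2 (pd j u) := fun j => pd_contDiff j hu (by norm_num)
  have h2 : ∀ i j, ContDiff ℝ 1 (pd i (pd j u)) := fun i j => pd_contDiff i (h1 j) (by norm_num)
  have hf1 : ∀ i, ContDiff ℝ 1 (pd i f) := fun i => pd_contDiff i hf (by norm_num)
  have hu2 : ContDiff ℝ 2 u := hu.of_le (by norm_num)
  have d1 : ∀ j x, DifferentiableAt ℝ (pd j u) x := fun j => (h1 j).differentiable (by norm_num)
  have d2 : ∀ i j x, DifferentiableAt ℝ (pd i (pd j u)) x :=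
    fun i j => (h2 i j).differentiable (by norm_num)
  have df : ∀ i x, DifferentiableAt ℝ (pd i f) x := fun i => (hf1 i).differentiable (by norm_num)
  -- differentiated equation
  have hdiff : ∀ j, ∑ i, pd j (pd i (pd i u)) x =
      ∑ i, (pd j (pd i f) x * pd i u x + pd i f x * pd j (pd i u) x)
        - p * u x ^ (p - 1) * pd j u x := by
    intro j
    have e : (fun y => ∑ i, pd i (pd i u) y) = fun y => (∑ i, pd i f y * pd i u y)
        + (-1) * u y ^ p := by
      funext y; linarith [heq y]
    have hA : DifferentiableAt ℝ (fun y => ∑ i, pd i (pd i u) y) x := by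
      have := (ContDiff.sum (s := Finset.univ) fun i _ => h2 i i).differentiable (by norm_num) x
      exact this
    have l1 := ld_sum (s := Finset.univ) fun i _ => pd_line j (d2 i i x)
    have l2 := ld_add (ld_sum (s := Finset.univ) fun i _ =>
      ld_mul (pd_line j (df i x)) (pd_line j (d1 i x)))
      (ld_const_mul (-1) (ld_rpow (pd_line j (hu2.differentiable (by norm_num) x)) (hpos x) p))
    have r1 := pd_eq hA l1
    rw [e] at hA r1
    have r2 := pd_eq hA l2
    rw [← r1, r2]
    ring
  have hexp : ∀ i, pd i (fun y => ∑ j, pd i (pd j u) y * pd j u y) x =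
      ∑ j, (pd j (pd i (pd i u)) x * pd j u x + pd i (pd j u) x ^ 2) := by
    intro i
    have hA : DifferentiableAt ℝ (fun y => ∑ j, pd i (pd j u) y * pd j u y) x := by
      have := (ContDiff.sum (s := Finset.univ) fun j _ =>
        (h2 i j).mul ((h1 j).of_le (by norm_num))).differentiable (n := 1) (by norm_num) x
      exact this
    rw [pd_eq hA (ld_sum fun j _ => ld_mul (pd_line i (d2 i j x)) (pd_line i (d1 j x)))]
    refine Finset.sum_congr rfl fun j _ => ?_
    have c1 : pd i (pd i (pd j u)) x = pd j (pd i (pd i u)) x := by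
      have : pd i (pd j u) = pd j (pd i u) := funext fun y => pd_comm i j hu2 y
      rw [this, pd_comm i j (h1 i)]
    rw [c1]
    ring
  unfold dvf
  simp only [hexp]
  have e1 : ∑ i, ∑ j, pd j (pd i (pd i u)) x * pd j u x =
      ∑ j, (∑ i, pd j (pd i (pd i u)) x) * pd j u x := by
    rw [Finset.sum_comm]
    simp only [Finset.sum_mul]
  have e2 : ∑ j, (∑ i, pd j (pd i (pd i u)) x) * pd j u x =
      ∑ j, ∑ i, pd j (pd i f) x * pd j u x * pd i u x
      + ∑ i, ∑ j, pd i f x * (pd i (pd j u) x * pd j u x)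
      - p * u x ^ (p - 1) * ∑ i, pd i u x * pd i u x := by
    simp only [hdiff]
    have : ∑ i, ∑ j, pd i f x * (pd i (pd j u) x * pd j u x) =
      ∑ j, ∑ i, pd i f x * (pd j (pd i u) x * pd j u x) := by
      rw [Finset.sum_comm]
      refine Finset.sum_congr rfl fun j _ => Finset.sum_congr rfl fun i _ => ?_
      rw [pd_comm i j hu2]
    rw [this, Finset.mul_sum, ← Finset.sum_add_distrib, ← Finset.sum_sub_distrib]
    refine Finset.sum_congr rfl fun j _ => ?_
    rw [sub_mul, Finset.sum_mul, ← Finset.sum_add_distrib]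
    congr 1
    · refine Finset.sum_congr rfl fun i _ => by ring
    · ring
  simp only [Finset.sum_sub_distrib, Finset.sum_add_distrib]
  rw [e1, e2]
  simp only [Finset.mul_sum]
  ring

lemma abs_le_sqrt_sum (w : Fin d → ℝ) (i : Fin d) : |w i| ≤ √(∑ j, w j * w j) := by
  apply Real.abs_le_sqrt
  rw [sq]
  exact Finset.single_le_sum (f := fun j => w j * w j) (fun j _ => mul_self_nonneg _)
    (Finset.mem_univ i)

/-- Low-dimensional case. -/
lemma case_two (hd : d = 2) (hp : 1 < p) (hf : ContDiff ℝ 2 f) (hu : ContDiff ℝ 3 u)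
    (hpos : ∀ x, 0 < u x)
    (heq : ∀ x, ∑ i, pd i (pd i u) x - ∑ i, pd i f x * pd i u x + u x ^ p = 0)
    (o : EuclideanSpace ℝ (Fin d)) (C : ℝ) (hC : 0 < C) (hvol : ∀ R : ℝ, 1 ≤ R →
        (∫ x in Metric.ball o R, Real.exp (-f x)) ≤ C * R ^ d) : False := by
  have h1 : ∀ j, ContDiff ℝ 1 (pd j u) := fun j => pd_contDiff j hu (by norm_num)
  have hu1 : ContDiff ℝ 1 u := hu.of_le (by norm_num)
  have hr := contDiff_rpow' hu1 hpos (-(1/2))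
  set V : Fin d → EuclideanSpace ℝ (Fin d) → ℝ :=
    fun i y => (-1) * (u y ^ (-(1/2) : ℝ) * pd i u y) with hV
  have hVc : ∀ i, ContDiff ℝ 1 (V i) := fun i => contDiff_const.mul (hr.mul (h1 i))
  have hform : ∀ x, dvf f V x = u x ^ (-(1/2) : ℝ) *
      ((∑ i, pd i u x * pd i u x) / u x / 2 + u x ^ p) := by
    intro x
    rw [hV, dvf_const_mul f (-1) (fun i y => u y ^ (-(1/2) : ℝ) * pd i u y)
      (fun i => hr.mul (h1 i)), dvf_smul f (fun y => u y ^ (-(1/2) : ℝ)) (fun i => pd i u) hr h1,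
      dvf_grad heq]
    have : ∑ i, pd i (fun y => u y ^ (-(1/2) : ℝ)) x * pd i u x =
        (-(1/2)) * u x ^ (-(1/2) - 1 : ℝ) * ∑ i, pd i u x * pd i u x := by
      rw [Finset.mul_sum]
      refine Finset.sum_congr rfl fun i _ => ?_
      rw [pd_rpow hu1 hpos]; ring
    rw [this, Real.rpow_sub_one (hpos x).ne']
    ring
  have hp1 : 0 < p - 1 := by linarith
  set κ : ℝ := (2 * p - 1) / (p - 1) with hκ
  have hκ2 : 2 < κ := by rw [hκ, lt_div_iff₀ hp1]; linarith
  have hge : ∀ x, 0 ≤ ∑ i, pd i u x * pd i u x := fun x =>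
    Finset.sum_nonneg fun i _ => mul_self_nonneg _
  refine core hf o C hC hvol V hVc (dvf f V) (fun x => rfl) ?_ κ (1 * (1/2) ^ (-(1 - 1 / κ)))
    (by positivity) (by linarith) (by rw [hd]; exact_mod_cast hκ2) ?_
  · intro x
    rw [hform]
    have := hpos x
    have := hge x
    positivity
  · intro i x
    have hU := hpos x
    have hg := hge x
    set U := u x
    set g := ∑ i, pd i u x * pd i u x with hgdef
    have hs : 0 < U ^ p := by positivity
    have hG : 0 ≤ g / U := by positivity
    refine expo_aux (U := U) (Q := g / U + U ^ p) (θ := 1 / 2) (σ := p) (b := -(1/2)) hU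
      (by positivity) (by linarith) ?_ ?_ (by linarith) (by norm_num) ?_ zero_le_one ?_
    · have : 1 / κ < 1 / 2 := one_div_lt_one_div_of_lt (by norm_num) hκ2
      linarith
    · rw [hκ]
      have : 2 * p - 1 ≠ 0 := by linarith
      field_simp
      ring
    · rw [hform]
      have : 0 ≤ U ^ (-(1/2) : ℝ) := by positivity
      have h5 : (1 / 2 : ℝ) * (g / U + U ^ p) ≤ g / U / 2 + U ^ p := by linarith
      nlinarith [mul_le_mul_of_nonneg_left h5 this]
    · have hb : |V i x| = U ^ (-(1/2) : ℝ) * |pd i u x| := by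
        simp only [hV, abs_mul, abs_neg, abs_one, one_mul]
        rw [abs_of_nonneg (by positivity)]
      rw [hb, one_mul, Real.rpow_add hU, mul_assoc]
      refine mul_le_mul_of_nonneg_left ?_ (by positivity)
      rw [← Real.mul_rpow hU.le (by positivity), ← Real.sqrt_eq_rpow]
      refine (abs_le_sqrt_sum (fun j => pd j u x) i).trans (Real.sqrt_le_sqrt ?_)
      have : U * (g / U + U ^ p) = g + U * U ^ p := by field_simp
      rw [this]
      have : 0 < U * U ^ p := by positivity
      change g ≤ _
      linarith

end


/-- The algebraic lower bound for the divergence. -/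
lemma lower_aux {D p τ ε G s Y N Hf : ℝ} (hD : 3 ≤ D) (hε : 0 < ε) (hε1 : ε < 1)
    (hG : 0 ≤ G) (hs : 0 ≤ s) (hN : 0 ≤ N) (hHf : 0 ≤ Hf) 
    (hA : 0 < (-(-τ + 2 * (1 - ε) * (τ * D / 2)) / 2) * (-τ - 1)
        - (1 - ε) * (τ * D / 2) ^ 2 * (1 - 1 / D))
    (hB : 0 < -(-(-τ + 2 * (1 - ε) * (τ * D / 2)) / 2) + 2 * (1 - ε) * (τ * D / 2) / D - p
        + (1 / D - 2 * ε) * (-τ + p))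
    (hH : (s + τ * D / 2 * G) ^ 2 / D + 2 * (τ * D / 2) * Y - (τ * D / 2) ^ 2 * G ^ 2 ≤ N) :
    min ε ((-(-τ + 2 * (1 - ε) * (τ * D / 2)) / 2) * (-τ - 1)
        - (1 - ε) * (τ * D / 2) ^ 2 * (1 - 1 / D)) * (G ^ 2 + N + s ^ 2) ≤
      (-(-τ + 2 * (1 - ε) * (τ * D / 2)) / 2) * ((-τ - 1) * G ^ 2 + 2 * Y - G * s)
        + (-τ * Y + N + Hf - p * s * G) + (1 / D - 2 * ε) * ((-τ + p) * s * G - s ^ 2) := by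
  set β := τ * D / 2 with hβ
  set c1 := -(-τ + 2 * (1 - ε) * β) / 2 with hc1
  set A := c1 * (-τ - 1) - (1 - ε) * β ^ 2 * (1 - 1 / D) with hAdef
  set B := -c1 + 2 * (1 - ε) * β / D - p + (1 / D - 2 * ε) * (-τ + p) with hBdef
  have hD0 : 0 < D := by linarith
  set m := min ε A with hm
  have m1 : m ≤ ε := min_le_left _ _
  have m2 : m ≤ A := min_le_right _ _
  have hDi : 1 / D ≤ 1 / 3 := one_div_le_one_div_of_le (by norm_num) hD
  have key : (1 - ε) * ((s + β * G) ^ 2 / D + 2 * β * Y - β ^ 2 * G ^ 2) ≤ (1 - ε) * N :=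
    mul_le_mul_of_nonneg_left hH (by linarith)
  have id1 : c1 * ((-τ - 1) * G ^ 2 + 2 * Y - G * s)
        + (-τ * Y + N + Hf - p * s * G) + (1 / D - 2 * ε) * ((-τ + p) * s * G - s ^ 2)
      = A * G ^ 2 + B * (s * G) + (2 * ε - ε * (1 / D)) * s ^ 2 + ε * N + Hf +
        ((1 - ε) * N - (1 - ε) * ((s + β * G) ^ 2 / D + 2 * β * Y - β ^ 2 * G ^ 2)) := by
    rw [hAdef, hBdef, hc1]
    field_simp
    ring
  rw [id1]
  have t1 : m * G ^ 2 ≤ A * G ^ 2 := by gcongr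
  have t2 : m * N ≤ ε * N := by gcongr
  have t3 : m * s ^ 2 ≤ (2 * ε - ε * (1 / D)) * s ^ 2 := by
    gcongr
    nlinarith
  have t4 : 0 ≤ B * (s * G) := by positivity
  nlinarith

section
variable {d : ℕ} {p : ℝ} {f u : EuclideanSpace ℝ (Fin d) → ℝ}

set_option maxHeartbeats 1600000 in
lemma case_main (hd : 3 ≤ d) (hp : 1 < p) (hps : ((d : ℝ) - 2) * p < (d : ℝ) + 2)
    (hf : ContDiff ℝ 2 f) (hconv : ConvexOn ℝ Set.univ f) (hu : ContDiff ℝ 3 u)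
    (hpos : ∀ x, 0 < u x)
    (heq : ∀ x, ∑ i, pd i (pd i u) x - ∑ i, pd i f x * pd i u x + u x ^ p = 0)
    (hdot : ∀ x, ∑ i, pd i f x * pd i u x ≤ 0)
    (o : EuclideanSpace ℝ (Fin d)) (C : ℝ) (hC : 0 < C) (hvol : ∀ R : ℝ, 1 ≤ R →
        (∫ x in Metric.ball o R, Real.exp (-f x)) ≤ C * R ^ d) : False := by
  have hD : (3:ℝ) ≤ d := by exact_mod_cast hd
  obtain ⟨τ, ε, hτ, hε, hε1, hτ2, hκd, hA, hB⟩ := param_aux hD hp hps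
  set c1 : ℝ := -(-τ + 2 * (1 - ε) * (τ * d / 2)) / 2 with hc1
  set δ : ℝ := min ε (c1 * (-τ - 1) - (1 - ε) * (τ * d / 2) ^ 2 * (1 - 1 / d)) with hδ
  have hδ0 : 0 < δ := lt_min hε hA
  set c3 : ℝ := 1 / d - 2 * ε with hc3
  have h1 : ∀ j, ContDiff ℝ 1 (pd j u) := fun j => pd_contDiff j hu (by norm_num)
  have h1' : ∀ j, ContDiff ℝ 2 (pd j u) := fun j => pd_contDiff j hu (by norm_num)
  have h2 : ∀ i j, ContDiff ℝ 1 (pd i (pd j u)) := fun i j => pd_contDiff i (h1' j) (by norm_num)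
  have hu1 : ContDiff ℝ 1 u := hu.of_le (by norm_num)
  have hr := fun a => contDiff_rpow' hu1 hpos a
  have hgc : ContDiff ℝ 1 (fun y => ∑ j, pd j u y * pd j u y) :=
    ContDiff.sum fun j _ => (h1 j).mul (h1 j)
  -- pieces of the vector field
  set X1 : Fin d → EuclideanSpace ℝ (Fin d) → ℝ :=
    fun i y => (∑ j, pd j u y * pd j u y) * pd i u y with hX1
  have hX1c : ∀ i, ContDiff ℝ 1 (X1 i) := fun i => hgc.mul (h1 i)
  set X2 : Fin d → EuclideanSpace ℝ (Fin d) → ℝ :=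
    fun i y => ∑ j, pd i (pd j u) y * pd j u y with hX2
  have hX2c : ∀ i, ContDiff ℝ 1 (X2 i) := fun i => ContDiff.sum fun j _ => (h2 i j).mul (h1 j)
  set W1 : Fin d → EuclideanSpace ℝ (Fin d) → ℝ :=
    fun i y => u y ^ (-τ - 1) * X1 i y with hW1
  have hW1c : ∀ i, ContDiff ℝ 1 (W1 i) := fun i => (hr _).mul (hX1c i)
  set W2 : Fin d → EuclideanSpace ℝ (Fin d) → ℝ :=
    fun i y => u y ^ (-τ) * X2 i y with hW2
  have hW2c : ∀ i, ContDiff ℝ 1 (W2 i) := fun i => (hr _).mul (hX2c i)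
  set W3 : Fin d → EuclideanSpace ℝ (Fin d) → ℝ :=
    fun i y => u y ^ (-τ + p) * pd i u y with hW3
  have hW3c : ∀ i, ContDiff ℝ 1 (W3 i) := fun i => (hr _).mul (h1 i)
  set V : Fin d → EuclideanSpace ℝ (Fin d) → ℝ :=
    fun i y => (c1 * W1 i y + W2 i y) + c3 * W3 i y with hV
  have hVc : ∀ i, ContDiff ℝ 1 (V i) := fun i =>
    ((contDiff_const.mul (hW1c i)).add (hW2c i)).add (contDiff_const.mul (hW3c i))
  -- divergences
  have q1 : ∀ x, dvf f W1 x = u x ^ (-τ) * ((-τ - 1) *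
      ((∑ j, pd j u x * pd j u x) / u x) ^ 2
      + 2 * ((∑ i, ∑ j, pd i (pd j u) x * pd i u x * pd j u x) / u x)
      - (∑ j, pd j u x * pd j u x) / u x * u x ^ p) := by
    intro x
    have hU := hpos x
    rw [hW1, dvf_smul f (fun y => u y ^ (-τ - 1)) X1 (hr _) hX1c, hX1,
      dvf_smul f (fun y => ∑ j, pd j u y * pd j u y) (fun i => pd i u) hgc h1, dvf_grad heq]
    have e1 : ∑ i, pd i (fun y => u y ^ (-τ - 1)) x * ((∑ j, pd j u x * pd j u x) * pd i u x) =
        (-τ - 1) * u x ^ (-τ - 1 - 1) * (∑ j, pd j u x * pd j u x) ^ 2 := by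
      rw [sq, Finset.mul_sum Finset.univ _ (∑ j, pd j u x * pd j u x), Finset.mul_sum]
      refine Finset.sum_congr rfl fun i _ => ?_
      rw [pd_rpow hu1 hpos]; ring
    have e2 : ∑ i, pd i (fun y => ∑ j, pd j u y * pd j u y) x * pd i u x =
        2 * ∑ i, ∑ j, pd i (pd j u) x * pd i u x * pd j u x := by
      rw [Finset.mul_sum]
      refine Finset.sum_congr rfl fun i _ => ?_
      rw [pd_gradsq hu, mul_assoc, Finset.sum_mul]
      congr 1
      refine Finset.sum_congr rfl fun j _ => by ring
    rw [e1, e2, Real.rpow_sub_one hU.ne', Real.rpow_sub_one hU.ne']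
    field_simp
    ring
  have q2 : ∀ x, dvf f W2 x = u x ^ (-τ) * (-τ *
      ((∑ i, ∑ j, pd i (pd j u) x * pd i u x * pd j u x) / u x)
      + ∑ i, ∑ j, pd i (pd j u) x ^ 2 + ∑ i, ∑ j, pd i (pd j f) x * pd i u x * pd j u x
        - p * u x ^ p * ((∑ i, pd i u x * pd i u x) / u x)) := by
    intro x
    have hU := hpos x
    rw [hW2, dvf_smul f (fun y => u y ^ (-τ)) X2 (hr _) hX2c, hX2, dvf_hess hf hu hpos heq]
    have e1 : ∑ i, pd i (fun y => u y ^ (-τ)) x * (∑ j, pd i (pd j u) x * pd j u x) =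
        (-τ) * u x ^ (-τ - 1) * ∑ i, ∑ j, pd i (pd j u) x * pd i u x * pd j u x := by
      rw [Finset.mul_sum]
      refine Finset.sum_congr rfl fun i _ => ?_
      rw [pd_rpow hu1 hpos, mul_assoc, Finset.mul_sum]
      congr 1
      refine Finset.sum_congr rfl fun j _ => by ring
    rw [e1, Real.rpow_sub_one hU.ne', Real.rpow_sub_one hU.ne']
    field_simp
    ring
  have q3 : ∀ x, dvf f W3 x = u x ^ (-τ) * ((-τ + p) * u x ^ p *
      ((∑ i, pd i u x * pd i u x) / u x) - (u x ^ p) ^ 2) := by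
    intro x
    have hU := hpos x
    rw [hW3, dvf_smul f (fun y => u y ^ (-τ + p)) (fun i => pd i u) (hr _) h1, dvf_grad heq]
    have e1 : ∑ i, pd i (fun y => u y ^ (-τ + p)) x * pd i u x =
        (-τ + p) * u x ^ (-τ + p - 1) * ∑ i, pd i u x * pd i u x := by
      rw [Finset.mul_sum]
      refine Finset.sum_congr rfl fun i _ => ?_
      rw [pd_rpow hu1 hpos, mul_assoc]
    rw [e1, Real.rpow_sub_one hU.ne', Real.rpow_add hU]
    field_simp
    ring
  have qV : ∀ x, dvf f V x = c1 * dvf f W1 x + dvf f W2 x + c3 * dvf f W3 x := by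
    intro x
    rw [hV, dvf_add f (fun i y => c1 * W1 i y + W2 i y) (fun i y => c3 * W3 i y)
      (fun i => (contDiff_const.mul (hW1c i)).add (hW2c i))
      (fun i => contDiff_const.mul (hW3c i)),
      dvf_add f (fun i y => c1 * W1 i y) W2 (fun i => contDiff_const.mul (hW1c i)) hW2c,
      dvf_const_mul f c1 W1 hW1c, dvf_const_mul f c3 W3 hW3c]
  -- lower bound
  have hge : ∀ x, 0 ≤ ∑ i, pd i u x * pd i u x := fun x =>
    Finset.sum_nonneg fun i _ => mul_self_nonneg _
  have hNn : ∀ x, 0 ≤ ∑ i, ∑ j, pd i (pd j u) x ^ 2 := fun x =>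
    Finset.sum_nonneg fun i _ => Finset.sum_nonneg fun j _ => sq_nonneg _
  have hlow : ∀ x, δ * (u x ^ (-τ) * (((∑ i, pd i u x * pd i u x) / u x) ^ 2
      + ∑ i, ∑ j, pd i (pd j u) x ^ 2 + (u x ^ p) ^ 2)) ≤ dvf f V x := by
    intro x
    have hU := hpos x
    have hs : 0 < u x ^ p := by positivity
    have hG : 0 ≤ (∑ i, pd i u x * pd i u x) / u x := div_nonneg (hge x) hU.le
    have hhess := hess_ineq (by omega) (fun i => pd i u x) (fun i j => pd i (pd j u) x) (u x ^ p)
      (τ * d / 2 / u x) hs.le (by positivity) (by linarith [heq x, hdot x])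
    have hl := lower_aux (Y := (∑ i, ∑ j, pd i (pd j u) x * pd i u x * pd j u x) / u x)
      hD hε hε1 hG hs.le (hNn x)
      (hess_nonneg hf hconv x (fun i => pd i u x)) hA hB (by
        refine le_trans (le_of_eq ?_) hhess
        have : (d:ℝ) ≠ 0 := by linarith
        field_simp)
    have hm := mul_le_mul_of_nonneg_left hl (show 0 ≤ u x ^ (-τ) by positivity)
    rw [qV, q1, q2, q3]
    refine le_trans (le_of_eq ?_) (hm.trans (le_of_eq ?_))
    · rw [hδ]; ring
    · ring
  have hp1 : 0 < p - 1 := by linarith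
  set κ : ℝ := 2 * (2 * p - τ) / (p - 1) with hκ
  have hκ4 : 4 < κ := by rw [hκ, lt_div_iff₀ hp1]; linarith
  have hκd' : (d : ℝ) < κ := by rw [hκ, lt_div_iff₀ hp1]; linarith
  set K : ℝ := |c1| + d + |c3| with hK
  have hK0 : 0 ≤ K := by positivity
  refine core hf o C hC hvol V hVc (dvf f V) (fun x => rfl) ?_ κ (K * δ ^ (-(1 - 1 / κ)))
    (by positivity) (by linarith) hκd' ?_
  · intro x
    refine lt_of_lt_of_le ?_ (hlow x)
    have hU := hpos x
    have := hNn x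
    have : 0 < u x ^ p := by positivity
    positivity
  · intro i x
    have hl := hlow x
    have hU := hpos x
    have hg := hge x
    have hN := hNn x
    have hw := fun i => abs_le_sqrt_sum (fun j => pd j u x) i
    have hH : ∀ i j, |pd i (pd j u) x| ≤ √(∑ i, ∑ j, pd i (pd j u) x ^ 2) := by
      intro i j
      apply Real.abs_le_sqrt
      refine le_trans ?_ (Finset.single_le_sum (f := fun i => ∑ j, pd i (pd j u) x ^ 2)
        (fun i _ => Finset.sum_nonneg fun j _ => sq_nonneg _) (Finset.mem_univ i))
      exact Finset.single_le_sum (f := fun j => pd i (pd j u) x ^ 2)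
        (fun j _ => sq_nonneg _) (Finset.mem_univ j)
    have hVx : V i x = c1 * (u x ^ (-τ - 1) * ((∑ j, pd j u x * pd j u x) * pd i u x))
      + u x ^ (-τ) * (∑ j, pd i (pd j u) x * pd j u x) + c3 * (u x ^ (-τ + p) * pd i u x) := rfl
    set U := u x with hUdef
    set g := ∑ i, pd i u x * pd i u x with hgdef
    set N := ∑ i, ∑ j, pd i (pd j u) x ^ 2 with hNdef
    set Q := (g / U) ^ 2 + N + (U ^ p) ^ 2 with hQ
    have hs : 0 < U ^ p := by positivity
    have hG : 0 ≤ g / U := by positivity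
    have hQ0 : 0 < Q := by positivity
    have sG : g / U ≤ √Q := Real.le_sqrt_of_sq_le (by rw [hQ]; nlinarith)
    have sN : √N ≤ √Q := Real.sqrt_le_sqrt (by rw [hQ]; nlinarith [sq_nonneg (g / U)])
    have sS : U ^ p ≤ √Q := Real.le_sqrt_of_sq_le (by rw [hQ]; nlinarith [sq_nonneg (g / U)])
    refine expo_aux (U := U) (Q := Q) (θ := 3 / 4) (σ := 2 * p) (b := -τ) hU hQ0 ?_ ?_ ?_
      (by linarith) hδ0 hl hK0 ?_
    · rw [mul_comm, Real.rpow_mul hU.le, Real.rpow_two, hQ]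
      nlinarith [sq_nonneg (g / U)]
    · have : 1 / κ < 1 / 4 := one_div_lt_one_div_of_lt (by norm_num) hκ4
      linarith
    · rw [hκ]
      have : 2 * p - τ ≠ 0 := by linarith
      field_simp
      ring
    · have hsg : √g ≤ U ^ (1/2 : ℝ) * Q ^ (1/4 : ℝ) := by
        have e : g = U * (g / U) := by field_simp
        have e2 : √(g / U) ≤ Q ^ (1/4 : ℝ) := by
          have := Real.sqrt_le_sqrt sG
          rw [Real.sqrt_eq_rpow (√Q), Real.sqrt_eq_rpow Q, ← Real.rpow_mul hQ0.le] at this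
          norm_num at this ⊢
          exact this
        rw [e, Real.sqrt_mul hU.le, Real.sqrt_eq_rpow U]
        gcongr
      have hfin : |V i x| ≤ K * (U ^ (-τ) * (√Q * √g)) := by
        have b1 : |c1 * (U ^ (-τ - 1) * (g * pd i u x))| ≤ |c1| * (U ^ (-τ) * (√Q * √g)) := by
          rw [abs_mul]
          refine mul_le_mul_of_nonneg_left ?_ (abs_nonneg _)
          rw [Real.rpow_sub_one hU.ne', abs_mul, abs_of_pos (by positivity), abs_mul,
            abs_of_nonneg hg]
          calc U ^ (-τ) / U * (g * |pd i u x|) = U ^ (-τ) * (g / U * |pd i u x|) := by ring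
            _ ≤ _ := by gcongr; exact hw i
        have b2 : |U ^ (-τ) * (∑ j, pd i (pd j u) x * pd j u x)| ≤
            d * (U ^ (-τ) * (√Q * √g)) := by
          rw [abs_mul, abs_of_pos (by positivity)]
          have : |∑ j, pd i (pd j u) x * pd j u x| ≤ d * (√Q * √g) := by
            calc _ ≤ ∑ j, |pd i (pd j u) x * pd j u x| := Finset.abs_sum_le_sum_abs _ _
              _ ≤ ∑ j : Fin d, √Q * √g := by
                refine Finset.sum_le_sum fun j _ => ?_
                rw [abs_mul]
                gcongr
                · exact (hH i j).trans sN
                · exact hw j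
              _ = _ := by simp
          calc _ ≤ U ^ (-τ) * (d * (√Q * √g)) := by gcongr
            _ = _ := by ring
        have b3 : |c3 * (U ^ (-τ + p) * pd i u x)| ≤ |c3| * (U ^ (-τ) * (√Q * √g)) := by
          rw [abs_mul]
          refine mul_le_mul_of_nonneg_left ?_ (abs_nonneg _)
          rw [abs_mul, abs_of_pos (by positivity), Real.rpow_add hU, mul_assoc]
          gcongr
          exact hw i
        rw [hVx]
        calc _ ≤ _ := abs_add_three _ _ _
          _ ≤ |c1| * (U ^ (-τ) * (√Q * √g)) + d * (U ^ (-τ) * (√Q * √g))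
            + |c3| * (U ^ (-τ) * (√Q * √g)) := by gcongr
          _ = _ := by rw [hK]; ring
      refine hfin.trans (mul_le_mul_of_nonneg_left ?_ hK0)
      calc U ^ (-τ) * (√Q * √g) ≤ U ^ (-τ) * (Q ^ (1/2:ℝ) * (U ^ (1/2 : ℝ) * Q ^ (1/4 : ℝ))) := by
            rw [← Real.sqrt_eq_rpow Q]
            gcongr
        _ = (U ^ (-τ) * U ^ (1/2:ℝ)) * (Q ^ (1/2:ℝ) * Q ^ (1/4 : ℝ)) := by ring
        _ = _ := by
            rw [← Real.rpow_add hU, ← Real.rpow_add hQ0]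
            norm_num

end

/-- Euclidean-base instance of Theorem 2.3: Liouville theorem for the subcritical
Lane-Emden equation with convex weight, ∇f·∇u ≤ 0 and Euclidean weighted volume growth. -/
theorem subcritical_laneEmden_liouville
    (d : ℕ) (hd : 2 ≤ d) (p : ℝ) (hp : 1 < p) (hps : ((d : ℝ) - 2) * p < (d : ℝ) + 2)
    (f u : EuclideanSpace ℝ (Fin d) → ℝ)
    (hf : ContDiff ℝ 2 f) (hconv : ConvexOn ℝ Set.univ f)
    (hu : ContDiff ℝ 3 u) (hunneg : ∀ x, 0 ≤ u x)
    (heq : ∀ x, lapl u x - ⟪gradient f x, gradient u x⟫ + u x ^ p = 0)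
    (hdot : ∀ x, ⟪gradient f x, gradient u x⟫ ≤ 0)
    (hvol : ∃ o : EuclideanSpace ℝ (Fin d), ∃ C : ℝ, 0 < C ∧ ∀ R : ℝ, 1 ≤ R →
        (∫ x in Metric.ball o R, Real.exp (-f x)) ≤ C * R ^ d) :
    ∀ x, u x = 0 := by
  have hu2 : ContDiff ℝ 2 u := hu.of_le (by norm_num)
  simp only [inner_gradient_eq] at heq hdot
  simp only [lapl_eq hu2] at heq
  obtain ⟨o, C, hC, hv⟩ := hvol
  by_cases hz : ∃ x₀, u x₀ = 0
  · obtain ⟨x₀, hx₀⟩ := hz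
    refine strong_max hu2 hunneg (fun x => ?_) hx₀
    have := heq x
    have := hdot x
    have := Real.rpow_nonneg (hunneg x) p
    linarith
  · push Not at hz
    have hpos : ∀ x, 0 < u x := fun x => lt_of_le_of_ne (hunneg x) (Ne.symm (hz x))
    exfalso
    rcases hd.eq_or_lt with h2 | h3
    · exact case_two h2.symm hp hf hu hpos heq o C hC hv
    · exact case_main h3 hp hps hf hconv hu hpos heq hdot o C hC hv
end

section
/- Let d ≥ 2 be an integer, let f : ℝ^d → ℝ be C², and let u : ℝ^d → ℝ be a non-negative C³ function satisfying Δu − ∇f·∇u + u^p = 0 on all of ℝ^d for some p > 1. If there exists o ∈ ℝ^d such that the weighted volume of balls satisfies ∫_{B_R(o)} e^{−f(x)} dx = o(R^{2p/(p−1)}) as R → +∞ (i.e., R^{−2p/(p−1)} ∫_{B_R(o)} e^{−f} dx → 0), then u ≡ 0. No curvature or convexity assumption on f is made. [Euclidean-base instance of Theorem 2.4.] -/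
open Real MeasureTheory Filter
open scoped RealInnerProductSpace

theorem pt_ineq (ε C : ℝ) (hε : 0 < ε) (hC : 0 ≤ C) (m : ℕ) (hm : 2 * (1 + ε) / ε ≤ m) :
    ∃ K : ℝ, 0 ≤ K ∧ ∀ δ a t : ℝ, 0 < δ → 0 ≤ a → 0 ≤ t → t ≤ 1 →
      C * δ ^ ε * (a + δ) ^ (1 + ε) * t ^ m ≤
        1 / 2 * a ^ (1 + 2 * ε) * t ^ (m + 2) + K * δ ^ (1 + 2 * ε) := by
  obtain ⟨s, hs⟩ : ∃ s : ℝ, s = 1 / 2 * ((2 : ℝ) ^ (1 + 2 * ε))⁻¹ := ⟨_, rfl⟩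
  have h2 : (0 : ℝ) < 2 ^ (1 + 2 * ε) := by positivity
  have hs0 : 0 < s := by rw [hs]; positivity
  refine ⟨1 / 2 + C * (C / s) ^ ((1 + ε) / ε), by positivity, ?_⟩
  intro δ a t hδ ha ht ht1
  have hv : 0 < a + δ := by positivity
  have hsum : s * (a + δ) ^ (1 + 2 * ε) ≤ 1 / 2 * (a ^ (1 + 2 * ε) + δ ^ (1 + 2 * ε)) := by
    have h3 : (a + δ) ^ (1 + 2 * ε) ≤ 2 ^ (1 + 2 * ε) * (a ^ (1 + 2 * ε) + δ ^ (1 + 2 * ε)) := by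
      have ha' : 0 ≤ a ^ (1 + 2 * ε) := by positivity
      have hd' : 0 ≤ δ ^ (1 + 2 * ε) := by positivity
      rcases le_total a δ with h | h
      · calc (a + δ) ^ (1 + 2 * ε) ≤ (2 * δ) ^ (1 + 2 * ε) := by
              apply Real.rpow_le_rpow <;> linarith
          _ = 2 ^ (1 + 2 * ε) * δ ^ (1 + 2 * ε) := Real.mul_rpow (by norm_num) hδ.le
          _ ≤ _ := by gcongr; linarith
      · calc (a + δ) ^ (1 + 2 * ε) ≤ (2 * a) ^ (1 + 2 * ε) := by
              apply Real.rpow_le_rpow <;> linarith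
          _ = 2 ^ (1 + 2 * ε) * a ^ (1 + 2 * ε) := Real.mul_rpow (by norm_num) ha
          _ ≤ _ := by gcongr; linarith
    calc s * (a + δ) ^ (1 + 2 * ε) ≤ s * _ := mul_le_mul_of_nonneg_left h3 hs0.le
      _ = _ := by rw [hs]; field_simp
  have hdp : 0 ≤ δ ^ (1 + 2 * ε) := by positivity
  have hvsplit : (a + δ) ^ (1 + 2 * ε) = (a + δ) ^ ε * (a + δ) ^ (1 + ε) := by
    rw [← Real.rpow_add hv]; congr 1; ring
  have hδsplit : δ ^ (1 + 2 * ε) = δ ^ ε * δ ^ (1 + ε) := by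
    rw [← Real.rpow_add hδ]; congr 1; ring
  by_cases hc : C * δ ^ ε ≤ s * (a + δ) ^ ε * t ^ 2
  · have ht2 : t ^ (m + 2) ≤ 1 := pow_le_one₀ ht ht1
    have : 0 ≤ C * (C / s) ^ ((1 + ε) / ε) * δ ^ (1 + 2 * ε) := by positivity
    calc C * δ ^ ε * (a + δ) ^ (1 + ε) * t ^ m
        ≤ s * (a + δ) ^ ε * t ^ 2 * (a + δ) ^ (1 + ε) * t ^ m := by gcongr
      _ = s * (a + δ) ^ (1 + 2 * ε) * t ^ (m + 2) := by rw [hvsplit]; ring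
      _ ≤ 1 / 2 * (a ^ (1 + 2 * ε) + δ ^ (1 + 2 * ε)) * t ^ (m + 2) := by gcongr
      _ ≤ _ := by nlinarith
  · push Not at hc
    have hlt : (a + δ) ^ ε * t ^ 2 ≤ C / s * δ ^ ε := by
      rw [div_mul_eq_mul_div, le_div_iff₀ hs0]; linarith
    have h4 := Real.rpow_le_rpow (by positivity) hlt (z := (1 + ε) / ε) (by positivity)
    rw [Real.mul_rpow (by positivity) (by positivity),
      Real.mul_rpow (by positivity) (by positivity), ← Real.rpow_mul hv.le,
      ← Real.rpow_mul hδ.le, mul_div_cancel₀ _ hε.ne', ← Real.rpow_natCast t 2,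
      ← Real.rpow_mul ht] at h4
    have h5 : t ^ m ≤ t ^ (((2 : ℕ) : ℝ) * ((1 + ε) / ε)) := by
      rcases ht.eq_or_lt with h0 | h0
      · have : m ≠ 0 := by
          rintro rfl
          have : 0 < 2 * (1 + ε) / ε := by positivity
          simp at hm; linarith
        rw [← h0, zero_pow this]; positivity
      · rw [← Real.rpow_natCast t m]
        apply Real.rpow_le_rpow_of_exponent_ge h0 ht1
        push_cast
        calc 2 * ((1 + ε) / ε) = 2 * (1 + ε) / ε := by ring
          _ ≤ m := hm
    have h6 : 0 ≤ 1 / 2 * a ^ (1 + 2 * ε) * t ^ (m + 2) := by positivity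
    calc C * δ ^ ε * (a + δ) ^ (1 + ε) * t ^ m
        ≤ C * δ ^ ε * ((a + δ) ^ (1 + ε) * t ^ (((2 : ℕ) : ℝ) * ((1 + ε) / ε))) := by
          rw [mul_assoc]; gcongr
      _ ≤ C * δ ^ ε * ((C / s) ^ ((1 + ε) / ε) * δ ^ (1 + ε)) := by gcongr
      _ = C * (C / s) ^ ((1 + ε) / ε) * δ ^ (1 + 2 * ε) := by rw [hδsplit]; ring
      _ ≤ _ := by nlinarith

theorem sum_dual {d : ℕ} (L : EuclideanSpace ℝ (Fin d) →L[ℝ] ℝ)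
    (u : EuclideanSpace ℝ (Fin d) → ℝ) (x : EuclideanSpace ℝ (Fin d)) :
    ∑ i : Fin d, L (EuclideanSpace.single i 1) * fderiv ℝ u x (EuclideanSpace.single i 1)
      = L (gradient u x) := by
  have h := (EuclideanSpace.basisFun (Fin d) ℝ).sum_repr' (gradient u x)
  conv_rhs => rw [← h]
  rw [map_sum]
  refine Finset.sum_congr rfl fun i _ => ?_
  rw [map_smul, smul_eq_mul, EuclideanSpace.basisFun_apply, inner_gradient_right]
  simp [mul_comm]

theorem ibp {d : ℕ} (w h : EuclideanSpace ℝ (Fin d) → ℝ) (hw : ContDiff ℝ 1 w)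
    (hh : ContDiff ℝ 1 h) (hc : HasCompactSupport w) (e : EuclideanSpace ℝ (Fin d)) :
    Integrable (fun x => w x * fderiv ℝ h x e) ∧ Integrable (fun x => fderiv ℝ w x e * h x) ∧
    ∫ x, w x * fderiv ℝ h x e = - ∫ x, fderiv ℝ w x e * h x := by
  have c1 : Continuous fun x => fderiv ℝ h x e :=
    (hh.continuous_fderiv one_ne_zero).clm_apply continuous_const
  have c2 : Continuous fun x => fderiv ℝ w x e :=
    (hw.continuous_fderiv one_ne_zero).clm_apply continuous_const
  have s2 : HasCompactSupport fun x => fderiv ℝ w x e := hc.fderiv_apply (𝕜 := ℝ) e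
  have i1 : Integrable (fun x => w x * fderiv ℝ h x e) :=
    (hw.continuous.mul c1).integrable_of_hasCompactSupport hc.mul_right
  have i2 : Integrable (fun x => fderiv ℝ w x e * h x) :=
    (c2.mul hh.continuous).integrable_of_hasCompactSupport s2.mul_right
  refine ⟨i1, i2, ?_⟩
  apply integral_mul_fderiv_eq_neg_fderiv_mul_of_integrable i2 i1
  · exact (hw.continuous.mul hh.continuous).integrable_of_hasCompactSupport hc.mul_right
  · exact fun x _ => hw.differentiable one_ne_zero x
  · exact fun x _ => hh.differentiable one_ne_zero x

theorem weak_form {d : ℕ} (p : ℝ)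
    (f u ψ : EuclideanSpace ℝ (Fin d) → ℝ)
    (hf : ContDiff ℝ 2 f) (hu : ContDiff ℝ 3 u)
    (heq : ∀ x, lapl u x - ⟪gradient f x, gradient u x⟫ + u x ^ p = 0)
    (hψ : ContDiff ℝ 1 ψ) (hc : HasCompactSupport ψ) :
    Integrable (fun x => rexp (-f x) * (ψ x * u x ^ p)) ∧
    Integrable (fun x => rexp (-f x) * fderiv ℝ ψ x (gradient u x)) ∧
    ∫ x, rexp (-f x) * (ψ x * u x ^ p) = ∫ x, rexp (-f x) * fderiv ℝ ψ x (gradient u x) := by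
  have hf1 : ContDiff ℝ 1 f := hf.of_le (by norm_num)
  have hA : ContDiff ℝ 1 fun x => rexp (-f x) := hf1.neg.exp
  set w : EuclideanSpace ℝ (Fin d) → ℝ := fun x => rexp (-f x) * ψ x with hwdef
  have hw : ContDiff ℝ 1 w := hA.mul hψ
  have hwc : HasCompactSupport w := hc.mul_left
  have hdu : ContDiff ℝ 2 (fderiv ℝ u) := hu.fderiv_right (by norm_num)
  have hh : ∀ e, ContDiff ℝ 1 fun x => fderiv ℝ u x e := fun e =>
    (hdu.clm_apply contDiff_const).of_le (by norm_num)
  have hI := fun i : Fin d => ibp w (fun x => fderiv ℝ u x (EuclideanSpace.single i 1)) hw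
    (hh _) hwc (EuclideanSpace.single i 1)
  have hsum : ∫ x, ∑ i : Fin d, w x * fderiv ℝ (fun y => fderiv ℝ u y (EuclideanSpace.single i 1))
        x (EuclideanSpace.single i 1)
      = - ∫ x, ∑ i : Fin d, fderiv ℝ w x (EuclideanSpace.single i 1) *
          fderiv ℝ u x (EuclideanSpace.single i 1) := by
    rw [integral_finsetSum _ fun i _ => (hI i).1, integral_finsetSum _ fun i _ => (hI i).2.1,
      ← Finset.sum_neg_distrib]
    exact Finset.sum_congr rfl fun i _ => (hI i).2.2
  have e1 : ∀ x, ∑ i : Fin d, w x * fderiv ℝ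
      (fun y => fderiv ℝ u y (EuclideanSpace.single i 1)) x (EuclideanSpace.single i 1)
      = w x * (fderiv ℝ f x (gradient u x)) - rexp (-f x) * (ψ x * u x ^ p) := by
    intro x
    have h1 := heq x
    rw [inner_gradient_left] at h1
    have h2 : lapl u x = ∑ i : Fin d, fderiv ℝ
      (fun y => fderiv ℝ u y (EuclideanSpace.single i 1)) x (EuclideanSpace.single i 1) := by
      refine Finset.sum_congr rfl fun i _ => ?_
      rw [iteratedFDeriv_two_apply, fderiv_clm_apply
        ((hdu.differentiable (by norm_num)).differentiableAt) (differentiableAt_const _)]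
      simp
    rw [← Finset.mul_sum, ← h2]
    have h3 : lapl u x = fderiv ℝ f x (gradient u x) - u x ^ p := by linarith
    rw [h3, hwdef]; ring
  have e2 : ∀ x, ∑ i : Fin d, fderiv ℝ w x (EuclideanSpace.single i 1) *
          fderiv ℝ u x (EuclideanSpace.single i 1)
      = rexp (-f x) * fderiv ℝ ψ x (gradient u x) - w x * fderiv ℝ f x (gradient u x) := by
    intro x
    rw [sum_dual]
    have hfx := (hf1.differentiable one_ne_zero x).hasFDerivAt
    have hψx := (hψ.differentiable one_ne_zero x).hasFDerivAt
    have := (hfx.neg.exp.mul hψx).fderiv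
    rw [show fderiv ℝ w x = _ from this]
    simp [hwdef]; ring
  simp_rw [e1, e2] at hsum
  have cg : Continuous fun x => gradient u x := by
    unfold gradient
    exact (LinearIsometryEquiv.continuous _).comp hdu.continuous
  have j1 : Integrable fun x => w x * (fderiv ℝ f x (gradient u x)) :=
    (hw.continuous.mul ((hf1.continuous_fderiv one_ne_zero).clm_apply cg)
      ).integrable_of_hasCompactSupport hwc.mul_right
  have j3 : Integrable fun x => rexp (-f x) * fderiv ℝ ψ x (gradient u x) := by
    refine (hA.continuous.mul ((hψ.continuous_fderiv one_ne_zero).clm_apply cg)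
      ).integrable_of_hasCompactSupport ?_
    refine HasCompactSupport.mul_left ?_
    refine (hc.fderiv (𝕜 := ℝ)).mono fun x hx => ?_
    simp only [Function.mem_support] at hx ⊢
    intro h0; apply hx; rw [h0]; rfl
  have j2 : Integrable fun x => rexp (-f x) * (ψ x * u x ^ p) := by
    have : (fun x => rexp (-f x) * (ψ x * u x ^ p)) = fun x => w x * (fderiv ℝ f x (gradient u x))
      - ∑ i : Fin d, w x * fderiv ℝ
      (fun y => fderiv ℝ u y (EuclideanSpace.single i 1)) x (EuclideanSpace.single i 1) := by
      funext x; rw [e1]; ring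
    rw [this]
    exact j1.sub (integrable_finsetSum _ fun i _ => (hI i).1)
  refine ⟨j2, j3, ?_⟩
  rw [integral_sub j1 j2, integral_sub j3 j1] at hsum
  linarith

theorem cutoff {d : ℕ} (o : EuclideanSpace ℝ (Fin d)) :
    ∃ C : ℝ, 0 ≤ C ∧ ∀ R : ℝ, 0 < R → ∃ φ : EuclideanSpace ℝ (Fin d) → ℝ,
      ContDiff ℝ 1 φ ∧ HasCompactSupport φ ∧ (∀ x, 0 ≤ φ x) ∧ (∀ x, φ x ≤ 1) ∧
      (∀ x, dist x o ≤ R → φ x = 1) ∧ (∀ x, x ∉ Metric.ball o (2 * R) → φ x = 0) ∧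
      ∀ x, ‖fderiv ℝ φ x‖ ≤ C * R⁻¹ := by
  let χ : ContDiffBump (0 : EuclideanSpace ℝ (Fin d)) := ⟨1, 2, by norm_num, by norm_num⟩
  have hχ : ContDiff ℝ 1 χ := χ.contDiff
  obtain ⟨C, hC⟩ := (hχ.continuous_fderiv one_ne_zero).bounded_above_of_compact_support
    (χ.hasCompactSupport.fderiv (𝕜 := ℝ))
  have hC0 : 0 ≤ C := (norm_nonneg _).trans (hC 0)
  refine ⟨C, hC0, fun R hR => ⟨fun x => χ (R⁻¹ • (x - o)), ?_, ?_, fun x => χ.nonneg,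
    fun x => χ.le_one, ?_, ?_, ?_⟩⟩
  · exact hχ.comp ((contDiff_id.sub contDiff_const).const_smul _)
  · apply HasCompactSupport.of_support_subset_isCompact (isCompact_closedBall o (2 * R))
    intro x hx
    by_contra hn
    apply hx
    apply χ.zero_of_le_dist
    rw [Metric.mem_closedBall, not_le] at hn
    rw [dist_zero_right, norm_smul, norm_inv, Real.norm_of_nonneg hR.le, ← dist_eq_norm,
      inv_mul_eq_div, le_div_iff₀ hR]
    exact hn.le
  · intro x hx
    apply χ.one_of_mem_closedBall
    rw [Metric.mem_closedBall, dist_zero_right, norm_smul, norm_inv, Real.norm_of_nonneg hR.le,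
      ← dist_eq_norm, inv_mul_eq_div, div_le_iff₀ hR]
    simpa [χ] using hx
  · intro x hn
    apply χ.zero_of_le_dist
    rw [Metric.mem_ball, not_lt] at hn
    rw [dist_zero_right, norm_smul, norm_inv, Real.norm_of_nonneg hR.le, ← dist_eq_norm,
      inv_mul_eq_div, le_div_iff₀ hR]
    exact hn
  · intro x
    have h1 : HasFDerivAt (fun x : EuclideanSpace ℝ (Fin d) => R⁻¹ • (x - o))
        (R⁻¹ • ContinuousLinearMap.id ℝ _) x := ((hasFDerivAt_id x).sub_const o).const_smul R⁻¹
    have h2 := ((hχ.differentiable one_ne_zero (R⁻¹ • (x - o))).hasFDerivAt.comp x h1).fderiv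
    rw [show fderiv ℝ (fun x => χ (R⁻¹ • (x - o))) x = _ from h2]
    rw [ContinuousLinearMap.comp_smul, ContinuousLinearMap.comp_id, norm_smul, norm_inv,
      Real.norm_of_nonneg hR.le, mul_comm]
    gcongr
    exact hC _

/-- The Cauchy-Schwarz step. -/
theorem young_step (ε k C r t v g X Y q : ℝ) (m : ℕ) (hε : 0 < ε) (hk : 0 ≤ k) (hC : 0 ≤ C)
    (hr : 0 < r) (ht : 0 ≤ t) (hv : 0 < v) (hg0 : 0 ≤ g) (hg : g ≤ 2) (hX : 0 ≤ X)
    (hY : Y ≤ C * r * X) :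
    g * (k * t ^ (m + 1) * Y) - t ^ (m + 2) * (ε * r * v ^ (-ε - 1) * X ^ 2)
      ≤ k ^ 2 * C ^ 2 / ε * r * v ^ (1 + ε) * t ^ m := by
  have h1 : g * (k * t ^ (m + 1) * Y) ≤ 2 * (k * t ^ (m + 1) * (C * r * X)) := by
    calc g * (k * t ^ (m + 1) * Y) ≤ g * (k * t ^ (m + 1) * (C * r * X)) := by gcongr
      _ ≤ _ := by gcongr
  have h2 : v ^ (-ε - 1) = (v ^ (1 + ε))⁻¹ := by rw [← Real.rpow_neg hv.le]; congr 1; ring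
  have hz : 0 < v ^ (1 + ε) := by positivity
  rw [h2]
  set z := v ^ (1 + ε)
  have h3 : 0 ≤ t ^ m * r / (ε * z) * (ε * t * X - k * C * z) ^ 2 := by positivity
  have h4 : t ^ m * r / (ε * z) * (ε * t * X - k * C * z) ^ 2
    = t ^ (m + 2) * (ε * r * z⁻¹ * X ^ 2) - 2 * (k * t ^ (m + 1) * (C * r * X))
      + k ^ 2 * C ^ 2 / ε * r * z * t ^ m := by
    field_simp
    ring
  linarith

theorem estimate {d : ℕ} (p : ℝ) (hp : 1 < p)
    (f u : EuclideanSpace ℝ (Fin d) → ℝ)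
    (hf : ContDiff ℝ 2 f)
    (hu : ContDiff ℝ 3 u) (hunneg : ∀ x, 0 ≤ u x)
    (heq : ∀ x, lapl u x - ⟪gradient f x, gradient u x⟫ + u x ^ p = 0)
    (o : EuclideanSpace ℝ (Fin d)) :
    ∃ K : ℝ, ∀ R : ℝ, 0 < R → ∃ θ : EuclideanSpace ℝ (Fin d) → ℝ,
      (∀ x, 0 ≤ θ x) ∧ (∀ x, dist x o ≤ R → θ x = 1) ∧
      Integrable (fun x => rexp (-f x) * (θ x * u x ^ p)) ∧
      ∫ x, rexp (-f x) * (θ x * u x ^ p) ≤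
        K * ((∫ x in Metric.ball o (2 * R), rexp (-f x)) / R ^ (2 * p / (p - 1))) := by
  obtain ⟨ε, hεdef⟩ : ∃ ε : ℝ, ε = (p - 1) / 2 := ⟨_, rfl⟩
  have hε : 0 < ε := by rw [hεdef]; linarith
  have hpε : 1 + 2 * ε = p := by rw [hεdef]; ring
  obtain ⟨C, hC, hcut⟩ := cutoff o
  obtain ⟨m, hm⟩ := exists_nat_ge (2 * (1 + ε) / ε)
  obtain ⟨K, hK, hpt⟩ := pt_ineq ε (((m + 2 : ℕ) : ℝ) ^ 2 * C ^ 2 / ε) hε (by positivity) m hm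
  refine ⟨2 * K, fun R hR => ?_⟩
  obtain ⟨φ, hφ, hφc, hφ0, hφ1, hφR, hφ2, hφd⟩ := hcut R hR
  have hu1 : ContDiff ℝ 1 u := hu.of_le (by norm_num)
  obtain ⟨δ, hδdef⟩ : ∃ δ : ℝ, δ = R ^ (-(1 / ε)) := ⟨_, rfl⟩
  have hδ : 0 < δ := by rw [hδdef]; positivity
  have hδε : δ ^ ε = R⁻¹ := by
    rw [hδdef, ← Real.rpow_mul hR.le, neg_mul, one_div_mul_cancel hε.ne', Real.rpow_neg_one]
  have hδp : δ ^ p = (R ^ (2 * p / (p - 1)))⁻¹ := by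
    rw [hδdef, ← Real.rpow_mul hR.le, ← Real.rpow_neg hR.le]
    congr 1; rw [hεdef]; field_simp
  have hv : ∀ x, 0 < u x + δ := fun x => add_pos_of_nonneg_of_pos (hunneg x) hδ
  set θ : EuclideanSpace ℝ (Fin d) → ℝ := fun x => φ x ^ (m + 2) with hθ
  set g : EuclideanSpace ℝ (Fin d) → ℝ := fun x => 1 + R⁻¹ * (u x + δ) ^ (-ε) with hgdef
  have hgC : ContDiff ℝ 1 g := contDiff_const.add (contDiff_const.mul
    ((hu1.add contDiff_const).rpow_const_of_ne fun x => (hv x).ne'))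
  have hθC : ContDiff ℝ 1 θ := hφ.pow _
  have hθc : HasCompactSupport θ := by
    refine hφc.mono fun x hx => ?_
    simp only [Function.mem_support, hθ] at hx ⊢
    intro h0; apply hx; rw [h0]; simp
  have hθ0 : ∀ x, 0 ≤ θ x := fun x => pow_nonneg (hφ0 x) _
  have hg1 : ∀ x, 1 ≤ g x := fun x => by
    have : 0 ≤ R⁻¹ * (u x + δ) ^ (-ε) := mul_nonneg (by positivity) (rpow_nonneg (hv x).le _)
    simp only [hgdef]; linarith
  have hg2 : ∀ x, g x ≤ 2 := fun x => by
    have : R⁻¹ * (u x + δ) ^ (-ε) ≤ 1 := by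
      rw [← hδε, Real.rpow_neg (hv x).le, ← div_eq_mul_inv]
      apply div_le_one_of_le₀ _ (rpow_nonneg (hv x).le _)
      exact Real.rpow_le_rpow hδ.le (by linarith [hunneg x]) hε.le
    simp only [hgdef]; linarith
  obtain ⟨i1, i2, hweak⟩ := weak_form p f u (fun x => θ x * g x) hf hu heq (hθC.mul hgC)
    hθc.mul_right
  obtain ⟨i3, -, -⟩ := weak_form p f u θ hf hu heq hθC hθc
  have hAc : Continuous fun x => rexp (-f x) := (hf.continuous.neg).rexp
  have iA : IntegrableOn (fun x => rexp (-f x)) (Metric.ball o (2 * R)) :=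
    (hAc.continuousOn.integrableOn_compact (isCompact_closedBall o (2 * R))).mono_set
      Metric.ball_subset_closedBall
  have iA' := (integrable_indicator_iff Metric.isOpen_ball.measurableSet).2 iA
  refine ⟨θ, hθ0, fun x hx => by simp [hθ, hφR x hx], i3, ?_⟩
  have hlow : ∫ x, rexp (-f x) * (θ x * u x ^ p) ≤ ∫ x, rexp (-f x) * (θ x * g x * u x ^ p) := by
    apply integral_mono i3 i1
    intro x
    have := rpow_nonneg (hunneg x) p
    have := hθ0 x
    have := hg1 x
    dsimp only
    gcongr
    nlinarith
  have hpoint : ∀ x, rexp (-f x) * fderiv ℝ (fun x => θ x * g x) x (gradient u x) ≤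
      1 / 2 * (rexp (-f x) * (θ x * u x ^ p)) +
        K * δ ^ p * (Metric.ball o (2 * R)).indicator (fun x => rexp (-f x)) x := by
    intro x
    have hφx := (hφ.differentiable one_ne_zero x).hasFDerivAt
    have hux := (hu1.differentiable one_ne_zero x).hasFDerivAt
    have hgx := ((((hux.add_const δ).rpow_const (p := -ε) (Or.inl (hv x).ne')).const_mul
      R⁻¹).const_add 1)
    have hD : fderiv ℝ (fun x => θ x * g x) x (gradient u x)
        = g x * (((m + 2 : ℕ) : ℝ) * φ x ^ (m + 1) * fderiv ℝ φ x (gradient u x))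
          - φ x ^ (m + 2) * (ε * R⁻¹ * (u x + δ) ^ (-ε - 1) * ‖gradient u x‖ ^ 2) := by
      have h := ((hφx.pow (m + 2)).mul hgx).fderiv
      rw [show fderiv ℝ (fun x => θ x * g x) x = _ from h]
      have hn : fderiv ℝ u x (gradient u x) = ‖gradient u x‖ ^ 2 := by
        rw [← inner_gradient_left, real_inner_self_eq_norm_sq]
      simp [hn, hgdef]
      ring
    have hbound : fderiv ℝ φ x (gradient u x) ≤ C * R⁻¹ * ‖gradient u x‖ :=
      (le_abs_self _).trans (((fderiv ℝ φ x).le_opNorm _).trans (by gcongr; exact hφd x))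
    by_cases hx : x ∈ Metric.ball o (2 * R)
    · rw [Set.indicator_of_mem hx]
      have h1 := young_step ε ((m + 2 : ℕ) : ℝ) C R⁻¹ (φ x) (u x + δ) (g x) ‖gradient u x‖
        (fderiv ℝ φ x (gradient u x)) 0 m hε (by positivity) hC (by positivity) (hφ0 x) (hv x)
        (by linarith [hg1 x]) (hg2 x) (norm_nonneg _) hbound
      have h2 := hpt δ (u x) (φ x) hδ (hunneg x) (hφ0 x) (hφ1 x)
      rw [hδε, hpε] at h2
      rw [← hD] at h1
      have h3 := mul_le_mul_of_nonneg_left (h1.trans h2) (Real.exp_pos (-f x)).le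
      refine h3.trans (le_of_eq ?_)
      simp only [hθ]; ring
    · rw [Set.indicator_of_notMem hx, hD, hφ2 x hx]
      simp [hθ, hφ2 x hx]
  have hup : ∫ x, rexp (-f x) * fderiv ℝ (fun x => θ x * g x) x (gradient u x) ≤
      1 / 2 * (∫ x, rexp (-f x) * (θ x * u x ^ p)) +
        K * δ ^ p * ∫ x in Metric.ball o (2 * R), rexp (-f x) := by
    rw [← integral_indicator Metric.isOpen_ball.measurableSet, ← integral_const_mul,
      ← integral_const_mul, ← integral_add (i3.const_mul _) (iA'.const_mul _)]
    exact integral_mono i2 ((i3.const_mul _).add (iA'.const_mul _)) hpoint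
  rw [div_eq_mul_inv, ← hδp]
  linarith

/-- Euclidean-base instance of Theorem 2.4: Liouville theorem under the sole volume
growth assumption μ(B_R(o)) = o(R^{2p/(p−1)}). -/
theorem laneEmden_liouville_volumeGrowth
    (d : ℕ) (hd : 2 ≤ d) (p : ℝ) (hp : 1 < p)
    (f u : EuclideanSpace ℝ (Fin d) → ℝ)
    (hf : ContDiff ℝ 2 f)
    (hu : ContDiff ℝ 3 u) (hunneg : ∀ x, 0 ≤ u x)
    (heq : ∀ x, lapl u x - ⟪gradient f x, gradient u x⟫ + u x ^ p = 0)
    (hvol : ∃ o : EuclideanSpace ℝ (Fin d),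
        Filter.Tendsto
          (fun R : ℝ => (∫ x in Metric.ball o R, Real.exp (-f x)) / R ^ (2 * p / (p - 1)))
          Filter.atTop (nhds 0)) :
    ∀ x, u x = 0 := by
  obtain ⟨o, ho⟩ := hvol
  obtain ⟨K, hK⟩ := estimate p hp f u hf hu hunneg heq o
  intro x0
  by_contra hne
  obtain ⟨C, -, hcut⟩ := cutoff o
  obtain ⟨φ, hφ, hφc, hφ0, hφ1, hφR, hφ2, -⟩ := hcut (dist x0 o + 1) (by positivity)
  have hcont : Continuous fun x => rexp (-f x) * (φ x * u x ^ p) :=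
    (hf.continuous.neg).rexp.mul (hφ.continuous.mul
      (hu.continuous.rpow_const fun x => Or.inr (by linarith)))
  have hcs : HasCompactSupport fun x => rexp (-f x) * (φ x * u x ^ p) :=
    (hφc.mul_right).mul_left
  have hpos : 0 < ∫ x, rexp (-f x) * (φ x * u x ^ p) := by
    refine hcont.integral_pos_of_hasCompactSupport_nonneg_nonzero hcs
      (fun x => mul_nonneg (Real.exp_pos _).le (mul_nonneg (hφ0 x) (rpow_nonneg (hunneg x) _)))
      (x := x0) ?_
    have hup : 0 < u x0 := lt_of_le_of_ne (hunneg x0) (Ne.symm hne)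
    rw [hφR x0 (by linarith)]
    positivity
  have hlim : Tendsto (fun R : ℝ => K * ((∫ x in Metric.ball o (2 * R), rexp (-f x)) /
      R ^ (2 * p / (p - 1)))) atTop (nhds 0) := by
    have h2 : Tendsto (fun R : ℝ => 2 * R) atTop atTop :=
      tendsto_id.const_mul_atTop (by norm_num)
    have h3 := (ho.comp h2).const_mul (K * 2 ^ (2 * p / (p - 1)))
    rw [mul_zero] at h3
    refine h3.congr' ?_
    filter_upwards [eventually_gt_atTop 0] with R hR
    simp only [Function.comp]
    rw [Real.mul_rpow (by norm_num) hR.le]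
    have : (0 : ℝ) < 2 ^ (2 * p / (p - 1)) := by positivity
    have : (0 : ℝ) < R ^ (2 * p / (p - 1)) := by positivity
    field_simp
  have hle : ∫ x, rexp (-f x) * (φ x * u x ^ p) ≤ 0 := by
    refine ge_of_tendsto hlim ?_
    filter_upwards [eventually_ge_atTop (2 * (dist x0 o + 1))] with R hR
    have hR0 : 0 < R := by have := dist_nonneg (x := x0) (y := o); linarith
    obtain ⟨θ, hθ0, hθ1, hθi, hθe⟩ := hK R hR0
    refine le_trans ?_ hθe
    refine integral_mono (hcont.integrable_of_hasCompactSupport hcs) hθi fun x => ?_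
    have hux := rpow_nonneg (hunneg x) p
    have : φ x ≤ θ x := by
      by_cases hx : x ∈ Metric.ball o (2 * (dist x0 o + 1))
      · rw [hθ1 x ((Metric.mem_ball.1 hx).le.trans hR)]; exact hφ1 x
      · rw [hφ2 x hx]; exact hθ0 x
    dsimp only
    gcongr
  linarith
end

section
/- Let d ≥ 3 be an integer and n > d a real number. Let f : ℝ^d → ℝ be C² and satisfy, for all x, ξ ∈ ℝ^d, the Bakry–Émery condition Hess f(x)[ξ,ξ] ≥ (∇f(x)·ξ)²/(n−d), where Hess f(x) is the second-derivative bilinear form of f at x. Then there is no positive C³ function u : ℝ^d → ℝ satisfying Δu − ∇f·∇u + u^{(n+2)/(n−2)} = 0 on all of ℝ^d together with the finite weighted energy condition ∫_{ℝ^d} e^{−f(x)} u(x)^{2n/(n−2)} dx < +∞. [Euclidean-base instance of Theorem 2.5 iv): on flat ℝ^d the conclusion of that theorem would force n = d, contradicting n > d.] -/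
open Real MeasureTheory Filter
open scoped RealInnerProductSpace

lemma aux_fderiv_zero {d : ℕ} (m : ℝ) (hm : 0 < m)
    (f : EuclideanSpace ℝ (Fin d) → ℝ) (hf : ContDiff ℝ 2 f)
    (hBE : ∀ x ξ : EuclideanSpace ℝ (Fin d),
      ⟪gradient f x, ξ⟫ ^ 2 / m ≤ iteratedFDeriv ℝ 2 f x ![ξ, ξ])
    (x ξ : EuclideanSpace ℝ (Fin d)) : fderiv ℝ f x ξ = 0 := by
  have hline : ∀ t : ℝ, HasDerivAt (fun t : ℝ => x + t • ξ) ξ t := by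
    intro t
    have := ((hasDerivAt_id t).smul_const ξ).const_add x
    simpa using this
  have hd1 : ∀ y, HasFDerivAt f (fderiv ℝ f y) y := fun y =>
    (hf.differentiable (by norm_num) y).hasFDerivAt
  have hf1 : ContDiff ℝ 1 (fderiv ℝ f) := hf.fderiv_right (by norm_num)
  have hd2 : ∀ y, HasFDerivAt (fderiv ℝ f) (fderiv ℝ (fderiv ℝ f) y) y := fun y =>
    (hf1.differentiable (by norm_num) y).hasFDerivAt
  have h1 : ∀ t : ℝ, HasDerivAt (fun t : ℝ => f (x + t • ξ)) (fderiv ℝ f (x + t • ξ) ξ) t :=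
    fun t => (hd1 (x + t • ξ)).comp_hasDerivAt t (hline t)
  have h2 : ∀ t : ℝ, HasDerivAt (fun t : ℝ => fderiv ℝ f (x + t • ξ) ξ)
      (fderiv ℝ (fderiv ℝ f) (x + t • ξ) ξ ξ) t := by
    intro t
    have hA : HasDerivAt (fun t : ℝ => fderiv ℝ f (x + t • ξ))
        (fderiv ℝ (fderiv ℝ f) (x + t • ξ) ξ) t := (hd2 (x + t • ξ)).comp_hasDerivAt t (hline t)
    exact (ContinuousLinearMap.apply ℝ ℝ ξ).hasFDerivAt.comp_hasDerivAt t hA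
  set g : ℝ → ℝ := fun t => Real.exp (-(f (x + t • ξ)) / m) with hg
  set g1 : ℝ → ℝ := fun t => Real.exp (-(f (x + t • ξ)) / m) * (-(fderiv ℝ f (x + t • ξ) ξ) / m)
    with hg1
  have hg' : ∀ t, HasDerivAt g (g1 t) t := fun t => ((h1 t).neg.div_const m).exp
  have hg1' : ∀ t, HasDerivAt g1 (Real.exp (-(f (x + t • ξ)) / m) *
      ((fderiv ℝ f (x + t • ξ) ξ) ^ 2 / m - fderiv ℝ (fderiv ℝ f) (x + t • ξ) ξ ξ) / m) t := by
    intro t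
    have := (hg' t).mul ((h2 t).neg.div_const m)
    refine HasDerivAt.congr_deriv this ?_
    simp only [hg, hg1, Pi.neg_apply]
    field_simp
    ring
  have hanti : Antitone g1 := by
    apply antitone_of_deriv_nonpos (fun t => (hg1' t).differentiableAt)
    intro t
    rw [(hg1' t).deriv]
    have hb := hBE (x + t • ξ) ξ
    rw [iteratedFDeriv_two_apply] at hb
    have hgr : ⟪gradient f (x + t • ξ), ξ⟫ = fderiv ℝ f (x + t • ξ) ξ := by
      simp [gradient]
    rw [hgr] at hb
    simp only [Matrix.cons_val_zero, Matrix.cons_val_one] at hb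
    apply div_nonpos_of_nonpos_of_nonneg _ hm.le
    exact mul_nonpos_of_nonneg_of_nonpos (Real.exp_pos _).le (by linarith)
  have hconc : ConcaveOn ℝ Set.univ g := by
    apply AntitoneOn.concaveOn_of_deriv convex_univ
    · exact fun t _ => (hg' t).continuousAt.continuousWithinAt
    · exact fun t _ => (hg' t).differentiableAt.differentiableWithinAt
    · have : deriv g = g1 := funext fun t => (hg' t).deriv
      rw [this]
      exact hanti.antitoneOn _
  have hpos : ∀ t, 0 < g t := fun t => Real.exp_pos _
  -- tangent bound
  have htan : ∀ t, g t ≤ g 0 + g1 0 * t := by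
    intro t
    rcases lt_trichotomy t 0 with h | h | h
    · have := hconc.le_slope_of_hasDerivAt (Set.mem_univ t) (Set.mem_univ 0) h (hg' 0)
      rw [slope_def_field, le_div_iff₀ (by linarith)] at this
      linarith
    · simp [h]
    · have := hconc.slope_le_of_hasDerivAt (Set.mem_univ 0) (Set.mem_univ t) h (hg' 0)
      rw [slope_def_field, div_le_iff₀ (by linarith)] at this
      linarith
  have hg10 : g1 0 = 0 := by
    by_contra hne
    have := htan (-(g 0) / g1 0)
    have h3 := hpos (-(g 0) / g1 0)
    have : g1 0 * (-(g 0) / g1 0) = - g 0 := by field_simp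
    linarith
  simp only [hg1] at hg10
  rcases mul_eq_zero.1 hg10 with h | h
  · exact absurd h (Real.exp_pos _).ne'
  · have := (div_eq_zero_iff.1 h).resolve_right hm.ne'
    simpa using this

lemma aux_ibp {d : ℕ} (η : EuclideanSpace ℝ (Fin d) → ℝ) (hη : ContDiff ℝ 1 η)
    (hc : HasCompactSupport η) (V : Fin d → EuclideanSpace ℝ (Fin d) → ℝ)
    (hV : ∀ i, ContDiff ℝ 1 (V i)) :
    ∫ x, η x * ∑ i, fderiv ℝ (V i) x (EuclideanSpace.single i 1) =
      - ∫ x, ∑ i, fderiv ℝ η x (EuclideanSpace.single i 1) * V i x := by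
  have hη' : Continuous (fderiv ℝ η) := hη.continuous_fderiv (by norm_num)
  have hV' : ∀ i, Continuous (fderiv ℝ (V i)) := fun i => (hV i).continuous_fderiv (by norm_num)
  have hi1 : ∀ i, Integrable
      (fun x => η x * fderiv ℝ (V i) x (EuclideanSpace.single i 1)) := fun i =>
    (hη.continuous.mul ((hV' i).clm_apply continuous_const)).integrable_of_hasCompactSupport
      hc.mul_right
  have hi2 : ∀ i, Integrable
      (fun x => fderiv ℝ η x (EuclideanSpace.single i 1) * V i x) := fun i =>
    ((hη'.clm_apply continuous_const).mul (hV i).continuous).integrable_of_hasCompactSupport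
      (hc.fderiv_apply ℝ (EuclideanSpace.single i 1)).mul_right
  have hi3 : ∀ i, Integrable (fun x => η x * V i x) := fun i =>
    (hη.continuous.mul (hV i).continuous).integrable_of_hasCompactSupport hc.mul_right
  simp_rw [Finset.mul_sum]
  rw [integral_finsetSum _ (fun i _ => hi1 i), integral_finsetSum _ (fun i _ => hi2 i),
    ← Finset.sum_neg_distrib]
  refine Finset.sum_congr rfl fun i _ => ?_
  exact integral_mul_fderiv_eq_neg_fderiv_mul_of_integrable (hi2 i) (hi1 i) (hi3 i)
    (fun x _ => hη.differentiable (by norm_num) x)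
    (fun x _ => (hV i).differentiable (by norm_num) x)

lemma aux_cutoff (d : ℕ) : ∃ M : ℝ, 0 < M ∧ ∃ η : ℕ → EuclideanSpace ℝ (Fin d) → ℝ,
    ∀ k, ContDiff ℝ 1 (η k) ∧ HasCompactSupport (η k) ∧ (∀ x, 0 ≤ η k x) ∧ (∀ x, η k x ≤ 1) ∧
      (∀ x, ‖x‖ ≤ (k : ℝ) + 1 → η k x = 1) ∧
      (∀ x, ‖fderiv ℝ (η k) x‖ ≤ M / ((k : ℝ) + 1)) ∧
      (∀ x, ‖x‖ < (k : ℝ) + 1 → fderiv ℝ (η k) x = 0) ∧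
      (∀ x, 2 * ((k : ℝ) + 1) < ‖x‖ → fderiv ℝ (η k) x = 0) := by
  let φ : ContDiffBump (0 : EuclideanSpace ℝ (Fin d)) := ⟨1, 2, by norm_num, by norm_num⟩
  have hφ : ContDiff ℝ 1 φ := φ.contDiff
  have hφc : HasCompactSupport φ := φ.hasCompactSupport
  obtain ⟨M, hM⟩ := (hφc.fderiv ℝ).exists_bound_of_continuous (hφ.continuous_fderiv (by norm_num))
  refine ⟨|M| + 1, by positivity, fun k x => φ (((k : ℝ) + 1)⁻¹ • x), fun k => ?_⟩
  have hk : (0 : ℝ) < (k : ℝ) + 1 := by positivity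
  have hnorm : ∀ x : EuclideanSpace ℝ (Fin d), ‖((k : ℝ) + 1)⁻¹ • x‖ = ‖x‖ / ((k : ℝ) + 1) := by
    intro x
    rw [norm_smul, norm_inv, Real.norm_of_nonneg hk.le]; field_simp
  have hone : ∀ x : EuclideanSpace ℝ (Fin d), ‖x‖ ≤ (k : ℝ) + 1 →
      φ (((k : ℝ) + 1)⁻¹ • x) = 1 := by
    intro x hx
    apply φ.one_of_mem_closedBall
    rw [mem_closedBall_zero_iff, hnorm]
    exact (div_le_one hk).2 hx
  refine ⟨hφ.comp (contDiff_const_smul _), ?_, fun x => φ.nonneg, fun x => φ.le_one, hone, ?_, ?_, ?_⟩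
  · exact hφc.comp_homeomorph (Homeomorph.smulOfNeZero _ (inv_ne_zero hk.ne'))
  · intro x
    rw [fderiv_comp_smul]
    rw [norm_smul, norm_inv, Real.norm_of_nonneg hk.le, div_eq_inv_mul]
    gcongr
    exact (hM _).trans ((le_abs_self M).trans (by linarith))
  · intro x hx
    have : (fun x => φ (((k : ℝ) + 1)⁻¹ • x)) =ᶠ[nhds x] fun _ => (1 : ℝ) := by
      filter_upwards [(isOpen_lt continuous_norm continuous_const).mem_nhds hx] with y hy
      exact hone y (le_of_lt hy)
    rw [this.fderiv_eq]; simp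
  · intro x hx
    have : (fun x => φ (((k : ℝ) + 1)⁻¹ • x)) =ᶠ[nhds x] fun _ => (0 : ℝ) := by
      filter_upwards [(isOpen_lt continuous_const continuous_norm).mem_nhds hx] with y hy
      apply φ.zero_of_le_dist
      rw [dist_zero_right, hnorm, le_div_iff₀ hk]
      exact (le_of_lt hy)
    rw [this.fderiv_eq]; simp

lemma aux_ui_contDiff {d : ℕ} (u : EuclideanSpace ℝ (Fin d) → ℝ) (hu : ContDiff ℝ 3 u)
    (v : EuclideanSpace ℝ (Fin d)) : ContDiff ℝ 2 (fun x => fderiv ℝ u x v) := by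
  have h : ContDiff ℝ 2 (fderiv ℝ u) := hu.fderiv_right (by norm_num)
  exact h.clm_apply contDiff_const

lemma aux_ui_fderiv {d : ℕ} (u : EuclideanSpace ℝ (Fin d) → ℝ) (hu : ContDiff ℝ 3 u)
    (x v w : EuclideanSpace ℝ (Fin d)) :
    fderiv ℝ (fun x => fderiv ℝ u x v) x w = iteratedFDeriv ℝ 2 u x ![w, v] := by
  have h : ContDiff ℝ 2 (fderiv ℝ u) := hu.fderiv_right (by norm_num)
  have h' := (h.differentiable (by norm_num) x).hasFDerivAt
  have h2 := ((ContinuousLinearMap.apply ℝ ℝ v).hasFDerivAt.comp x h').fderiv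
  have h3 : fderiv ℝ (fun x => fderiv ℝ u x v) x =
    (ContinuousLinearMap.apply ℝ ℝ v).comp (fderiv ℝ (fderiv ℝ u) x) := h2
  rw [h3, iteratedFDeriv_two_apply]
  simp

lemma aux_symm {d : ℕ} (u : EuclideanSpace ℝ (Fin d) → ℝ) (hu : ContDiff ℝ 3 u)
    (x v w : EuclideanSpace ℝ (Fin d)) :
    iteratedFDeriv ℝ 2 u x ![v, w] = iteratedFDeriv ℝ 2 u x ![w, v] := by
  have h : IsSymmSndFDerivAt ℝ u x :=
    (hu.contDiffAt (x := x)).isSymmSndFDerivAt (by simp; norm_num)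
  rw [iteratedFDeriv_two_apply, iteratedFDeriv_two_apply]
  exact h v w

/-- line derivative from differentiability -/
lemma aux_line {d : ℕ} {g : EuclideanSpace ℝ (Fin d) → ℝ} {x v : EuclideanSpace ℝ (Fin d)}
    (hg : DifferentiableAt ℝ g x) :
    HasDerivAt (fun t : ℝ => g (x + t • v)) (fderiv ℝ g x v) 0 :=
  hg.hasFDerivAt.hasLineDerivAt v

lemma aux_fderiv_of_line {d : ℕ} {g : EuclideanSpace ℝ (Fin d) → ℝ}
    {x v : EuclideanSpace ℝ (Fin d)} (hg : DifferentiableAt ℝ g x) {a : ℝ}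
    (h : HasDerivAt (fun t : ℝ => g (x + t • v)) a 0) : fderiv ℝ g x v = a :=
  (aux_line hg).unique h

lemma aux_div1 {d : ℕ} (u : EuclideanSpace ℝ (Fin d) → ℝ) (hu : ContDiff ℝ 3 u)
    (x : EuclideanSpace ℝ (Fin d)) :
    ∑ i, fderiv ℝ (fun x => u x * fderiv ℝ u x (EuclideanSpace.single i 1)) x
      (EuclideanSpace.single i 1) =
    (∑ i, (fderiv ℝ u x (EuclideanSpace.single i 1)) ^ 2) + u x * lapl u x := by
  have hdu : DifferentiableAt ℝ u x := hu.differentiable (by norm_num) x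
  have hdi : ∀ i, DifferentiableAt ℝ
      (fun x => fderiv ℝ u x (EuclideanSpace.single (i : Fin d) 1)) x := fun i =>
    (aux_ui_contDiff u hu _).differentiable (by norm_num) x
  unfold lapl
  rw [Finset.mul_sum, ← Finset.sum_add_distrib]
  refine Finset.sum_congr rfl fun i _ => ?_
  apply aux_fderiv_of_line (hdu.mul (hdi i))
  have := (aux_line (v := EuclideanSpace.single i 1) hdu).mul
    (aux_line (v := EuclideanSpace.single i 1) (hdi i))
  refine HasDerivAt.congr_deriv this ?_
  rw [aux_ui_fderiv u hu]
  simp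
  ring

/-- Pohozaev field -/
noncomputable def pohoV {d : ℕ} (u : EuclideanSpace ℝ (Fin d) → ℝ) (q : ℝ) (i : Fin d)
    (x : EuclideanSpace ℝ (Fin d)) : ℝ :=
  (∑ j, x j * fderiv ℝ u x (EuclideanSpace.single j 1)) * fderiv ℝ u x (EuclideanSpace.single i 1)
    - x i * (∑ j, (fderiv ℝ u x (EuclideanSpace.single j 1)) ^ 2) / 2 + x i * (u x ^ q) / q

lemma aux_pohoV_contDiff {d : ℕ} (u : EuclideanSpace ℝ (Fin d) → ℝ) (hu : ContDiff ℝ 3 u)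
    (hpos : ∀ x, 0 < u x) (q : ℝ) (i : Fin d) : ContDiff ℝ 1 (pohoV u q i) := by
  have hui : ∀ j : Fin d, ContDiff ℝ 1 (fun x => fderiv ℝ u x (EuclideanSpace.single j 1)) :=
    fun j => (aux_ui_contDiff u hu _).of_le (by norm_num)
  have hx : ∀ j : Fin d, ContDiff ℝ 1 (fun x : EuclideanSpace ℝ (Fin d) => x j) := fun j =>
    (EuclideanSpace.proj j : EuclideanSpace ℝ (Fin d) →L[ℝ] ℝ).contDiff
  have huq : ContDiff ℝ 1 (fun x => u x ^ q) :=
    (hu.of_le (by norm_num)).rpow_const_of_ne (fun x => (hpos x).ne')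
  unfold pohoV
  exact (((ContDiff.sum fun j _ => (hx j).mul (hui j)).mul (hui i)).sub
    (((hx i).mul (ContDiff.sum fun j _ => (hui j).pow 2)).div_const 2)).add
    (((hx i).mul huq).div_const q)

lemma aux_div2 {d : ℕ} (u : EuclideanSpace ℝ (Fin d) → ℝ) (hu : ContDiff ℝ 3 u)
    (hpos : ∀ x, 0 < u x) (q : ℝ) (hq : q ≠ 0) (x : EuclideanSpace ℝ (Fin d))
    (heq : lapl u x + u x ^ (q - 1) = 0) :
    ∑ i, fderiv ℝ (pohoV u q i) x (EuclideanSpace.single i 1) =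
    (1 - (d : ℝ) / 2) * (∑ i, (fderiv ℝ u x (EuclideanSpace.single i 1)) ^ 2)
      + d / q * u x ^ q := by
  have hdu : DifferentiableAt ℝ u x := hu.differentiable (by norm_num) x
  have hdi : ∀ i, DifferentiableAt ℝ
      (fun x => fderiv ℝ u x (EuclideanSpace.single (i : Fin d) 1)) x := fun i =>
    (aux_ui_contDiff u hu _).differentiable (by norm_num) x
  have hxl : ∀ i j : Fin d, HasDerivAt
      (fun t : ℝ => (x + t • (EuclideanSpace.single i (1 : ℝ) : EuclideanSpace ℝ (Fin d))) j)
      (if j = i then 1 else 0) 0 := by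
    intro i j
    have h1 := ((hasDerivAt_id (0 : ℝ)).mul_const (if j = i then (1 : ℝ) else 0)).const_add (x j)
    rw [one_mul] at h1
    refine h1.congr_of_eventuallyEq (Filter.Eventually.of_forall fun t => ?_)
    simp
  set w : Fin d → ℝ := fun j => fderiv ℝ u x (EuclideanSpace.single j 1) with hw
  set H : Fin d → Fin d → ℝ := fun i j =>
    iteratedFDeriv ℝ 2 u x ![EuclideanSpace.single i 1, EuclideanSpace.single j 1] with hH
  have key : ∀ i, fderiv ℝ (pohoV u q i) x (EuclideanSpace.single i 1) =
      (w i + ∑ j, x j * H i j) * w i + (∑ j, x j * w j) * H i i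
      - (∑ j, w j ^ 2) / 2 - x i * (∑ j, w j * H i j) + u x ^ q / q
      + x i * (u x ^ (q - 1) * w i) := by
    intro i
    apply aux_fderiv_of_line ((aux_pohoV_contDiff u hu hpos q i).differentiable (by norm_num) x)
    have hl : ∀ j, HasDerivAt (fun t : ℝ =>
        fderiv ℝ u (x + t • EuclideanSpace.single i 1) (EuclideanSpace.single j 1)) (H i j) 0 := by
      intro j
      have := aux_line (v := EuclideanSpace.single i 1) (hdi j)
      rwa [aux_ui_fderiv u hu] at this
    have hA := HasDerivAt.fun_sum (u := Finset.univ) fun j _ => (hxl i j).mul (hl j)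
    have hB := HasDerivAt.fun_sum (u := Finset.univ) fun j _ => (hl j).pow 2
    have hC := (aux_line (v := EuclideanSpace.single i 1) hdu).rpow_const (p := q)
      (Or.inl (by simpa using (hpos x).ne'))
    have hT := ((hA.mul (hl i)).sub (((hxl i i).mul hB).div_const 2)).add
      (((hxl i i).mul hC).div_const q)
    refine HasDerivAt.congr_deriv hT ?_
    simp [Finset.sum_add_distrib, hw, mul_assoc, ← Finset.mul_sum]
    field_simp
    ring
  rw [Finset.sum_congr rfl fun i _ => key i]
  have hlap : ∑ i, H i i = - u x ^ (q - 1) := by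
    have : lapl u x = ∑ i, H i i := rfl
    linarith
  simp only [Finset.sum_add_distrib, Finset.sum_sub_distrib, add_mul]
  rw [← Finset.mul_sum, hlap]
  have e1 : ∑ i, (∑ j, x j * H i j) * w i = ∑ i, x i * ∑ j, w j * H i j := by
    simp_rw [Finset.sum_mul, Finset.mul_sum]
    rw [Finset.sum_comm]
    refine Finset.sum_congr rfl fun i _ => Finset.sum_congr rfl fun j _ => ?_
    have : H j i = H i j := aux_symm u hu x _ _
    rw [this]; ring
  have e2 : ∑ i, x i * (u x ^ (q - 1) * w i) = u x ^ (q - 1) * ∑ j, x j * w j := by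
    rw [Finset.mul_sum]; exact Finset.sum_congr rfl fun i _ => by ring
  rw [e1, e2]
  simp only [Finset.sum_const, Finset.card_univ, Fintype.card_fin, nsmul_eq_mul]
  have e3 : ∑ i, w i * w i = ∑ i, w i ^ 2 := Finset.sum_congr rfl fun i _ => by ring
  rw [e3]
  ring

lemma aux_tail {d : ℕ} (g : EuclideanSpace ℝ (Fin d) → ℝ) (hg : Integrable g) :
    Tendsto (fun k : ℕ => ∫ x, ({x | (k : ℝ) + 1 ≤ ‖x‖} : Set _).indicator g x) atTop (nhds 0) := by
  have hS : ∀ k : ℕ, MeasurableSet ({x | (k : ℝ) + 1 ≤ ‖x‖} : Set (EuclideanSpace ℝ (Fin d))) :=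
    fun k => measurableSet_le measurable_const measurable_norm
  have h0 : (0 : ℝ) = ∫ x : EuclideanSpace ℝ (Fin d), (0 : ℝ) := by simp
  rw [h0]
  refine tendsto_integral_of_dominated_convergence (fun x => ‖g x‖)
    (fun k => (hg.indicator (hS k)).aestronglyMeasurable) hg.norm
    (fun k => Eventually.of_forall fun x => norm_indicator_le_norm_self _ _)
    (Eventually.of_forall fun x => ?_)
  apply tendsto_const_nhds.congr'
  obtain ⟨N, hN⟩ := exists_nat_gt ‖x‖
  filter_upwards [eventually_ge_atTop N] with k hk
  rw [Set.indicator_of_notMem]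
  simp only [Set.mem_ofPred_eq, not_le]
  have : (N : ℝ) ≤ k := by exact_mod_cast hk
  linarith

lemma aux_cut {d : ℕ} (g : EuclideanSpace ℝ (Fin d) → ℝ) (hg : Integrable g)
    (ζ : ℕ → EuclideanSpace ℝ (Fin d) → ℝ) (hc : ∀ k, Continuous (ζ k))
    (h0 : ∀ k x, 0 ≤ ζ k x) (h1 : ∀ k x, ζ k x ≤ 1)
    (hone : ∀ (k : ℕ) x, ‖x‖ ≤ (k : ℝ) + 1 → ζ k x = 1) :
    Tendsto (fun k : ℕ => ∫ x, ζ k x * g x) atTop (nhds (∫ x, g x)) := by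
  refine tendsto_integral_of_dominated_convergence (fun x => ‖g x‖)
    (fun k => (hc k).aestronglyMeasurable.mul hg.aestronglyMeasurable) hg.norm
    (fun k => Eventually.of_forall fun x => ?_)
    (Eventually.of_forall fun x => ?_)
  · rw [norm_mul, Real.norm_of_nonneg (h0 k x)]
    exact mul_le_of_le_one_left (norm_nonneg _) (h1 k x)
  apply tendsto_const_nhds.congr'
  obtain ⟨N, hN⟩ := exists_nat_gt ‖x‖
  filter_upwards [eventually_ge_atTop N] with k hk
  have : (N : ℝ) ≤ k := by exact_mod_cast hk
  rw [hone k x (by linarith), one_mul]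

lemma aux_sum_clm {d : ℕ} (L : EuclideanSpace ℝ (Fin d) →L[ℝ] ℝ) (w : EuclideanSpace ℝ (Fin d)) :
    ∑ i, L (EuclideanSpace.single i 1) * w i = L w := by
  have : w = ∑ i, w i • (EuclideanSpace.single i 1 : EuclideanSpace ℝ (Fin d)) := by
    ext j
    simp [Finset.sum_apply, Pi.single_apply]
  conv_rhs => rw [this]
  rw [map_sum]
  exact Finset.sum_congr rfl fun i _ => by rw [map_smul, smul_eq_mul, mul_comm]

lemma aux_cs {d : ℕ} (L : EuclideanSpace ℝ (Fin d) →L[ℝ] ℝ) (w : Fin d → ℝ) :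
    |∑ i, L (EuclideanSpace.single i 1) * w i| ≤ ‖L‖ * Real.sqrt (∑ i, w i ^ 2) := by
  have h := aux_sum_clm L (WithLp.toLp 2 w)
  simp only at h
  rw [h]
  have h2 := L.le_opNorm (WithLp.toLp 2 w)
  rw [EuclideanSpace.norm_eq] at h2
  simpa using h2

lemma aux_young (n : ℝ) (hn : 2 < n) (a R : ℝ) (ha : 0 < a) (hR : 0 < R) :
    a ^ 2 / R ^ 2 ≤ a ^ (2 * n / (n - 2)) + R ^ (-n) := by
  have hP : (n / (n - 2)).HolderConjugate (n / 2) := by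
    rw [Real.holderConjugate_iff]
    have : 0 < n - 2 := by linarith
    refine ⟨(one_lt_div this).2 (by linarith), ?_⟩
    field_simp
    ring
  have h := Real.young_inequality_of_nonneg (a := a ^ 2) (b := (R ^ 2)⁻¹) (by positivity)
    (by positivity) hP
  have e1 : (a ^ 2) ^ (n / (n - 2)) = a ^ (2 * n / (n - 2)) := by
    rw [← Real.rpow_natCast, ← Real.rpow_mul ha.le]
    congr 1; push_cast; ring
  have e2 : ((R ^ 2)⁻¹) ^ (n / 2) = R ^ (-n) := by
    rw [Real.inv_rpow (by positivity), ← Real.rpow_natCast, ← Real.rpow_mul hR.le, Real.rpow_neg hR.le]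
    congr 2; push_cast; ring
  rw [e1, e2] at h
  rw [div_eq_mul_inv]
  refine h.trans (add_le_add ?_ ?_)
  · exact div_le_self (Real.rpow_nonneg ha.le _) hP.lt.le
  · exact div_le_self (Real.rpow_nonneg hR.le _) hP.symm.lt.le

lemma aux_ball {d : ℕ} (n : ℝ) (hn : (d : ℝ) < n) :
    Tendsto (fun k : ℕ => ∫ x, (Metric.closedBall (0 : EuclideanSpace ℝ (Fin d))
      (2 * ((k : ℝ) + 1))).indicator (fun _ => ((k : ℝ) + 1) ^ (-n)) x) atTop (nhds 0) := by
  have e : ∀ k : ℕ, ∫ x, (Metric.closedBall (0 : EuclideanSpace ℝ (Fin d))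
      (2 * ((k : ℝ) + 1))).indicator (fun _ => ((k : ℝ) + 1) ^ (-n)) x =
      (2 ^ d * volume.real (Metric.ball (0 : EuclideanSpace ℝ (Fin d)) 1)) *
        ((k : ℝ) + 1) ^ (-(n - d)) := by
    intro k
    have hk : (0 : ℝ) < (k : ℝ) + 1 := by positivity
    rw [integral_indicator_const _ Metric.isClosed_closedBall.measurableSet, smul_eq_mul,
      Measure.addHaar_real_closedBall _ _ (by positivity)]
    have : ((k : ℝ) + 1) ^ (-(n - d)) = ((k : ℝ) + 1) ^ d * ((k : ℝ) + 1) ^ (-n) := by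
      rw [← Real.rpow_natCast, ← Real.rpow_add hk]; congr 1; ring
    rw [this]
    simp [mul_pow]
    ring
  simp_rw [e]
  have h1 : Tendsto (fun k : ℕ => (k : ℝ) + 1) atTop atTop :=
    tendsto_atTop_add_const_right _ _ tendsto_natCast_atTop_atTop
  have h2 := (tendsto_rpow_neg_atTop (y := n - d) (by linarith)).comp h1
  simpa using h2.const_mul (2 ^ d * volume.real (Metric.ball (0 : EuclideanSpace ℝ (Fin d)) 1))

lemma aux_core {d : ℕ} (hd : 3 ≤ d) (n : ℝ) (hn : (d : ℝ) < n)
    (u : EuclideanSpace ℝ (Fin d) → ℝ) (hu : ContDiff ℝ 3 u) (hpos : ∀ x, 0 < u x)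
    (heq : ∀ x, lapl u x + u x ^ ((n + 2) / (n - 2)) = 0)
    (hF : Integrable (fun x => u x ^ (2 * n / (n - 2)))) : False := by
  have hd3 : (3 : ℝ) ≤ d := by exact_mod_cast hd
  have hn2 : 0 < n - 2 := by linarith
  obtain ⟨M, hM, η, hη⟩ := aux_cutoff d
  choose hηC hηc hη0 hη1 hηone hηM hηz1 hηz2 using hη
  set q : ℝ := 2 * n / (n - 2) with hq
  have hq1 : (n + 2) / (n - 2) = q - 1 := by rw [hq]; field_simp; ring
  have hq2 : 1 ≤ q := by rw [hq, le_div_iff₀ hn2]; linarith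
  set F : EuclideanSpace ℝ (Fin d) → ℝ := fun x => u x ^ q with hFdef
  set w : EuclideanSpace ℝ (Fin d) → Fin d → ℝ :=
    fun x i => fderiv ℝ u x (EuclideanSpace.single i 1) with hw
  set G : EuclideanSpace ℝ (Fin d) → ℝ := fun x => ∑ i, w x i ^ 2 with hG
  have hF0 : ∀ x, 0 < F x := fun x => Real.rpow_pos_of_pos (hpos x) _
  have hG0 : ∀ x, 0 ≤ G x := fun x => Finset.sum_nonneg fun i _ => sq_nonneg _
  have huc : Continuous u := hu.continuous
  have hFc : Continuous F := huc.rpow_const (fun x => Or.inl (hpos x).ne')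
  have hwc : ∀ i, Continuous (fun x => w x i) := fun i => (aux_ui_contDiff u hu _).continuous
  have hGc : Continuous G := continuous_finsetSum _ fun i _ => (hwc i).pow 2
  have hk0 : ∀ k : ℕ, (0 : ℝ) < (k : ℝ) + 1 := fun k => by positivity
  let S : ℕ → Set (EuclideanSpace ℝ (Fin d)) := fun k => {x | (k : ℝ) + 1 ≤ ‖x‖}
  have hS : ∀ k, MeasurableSet (S k) := fun k => measurableSet_le measurable_const measurable_norm
  let B : ℕ → EuclideanSpace ℝ (Fin d) → ℝ := fun k =>
    (Metric.closedBall (0 : EuclideanSpace ℝ (Fin d))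
      (2 * ((k : ℝ) + 1))).indicator (fun _ => ((k : ℝ) + 1) ^ (-n))
  have hB0 : ∀ k x, 0 ≤ B k x := fun k x =>
    Set.indicator_nonneg (fun _ _ => Real.rpow_nonneg (hk0 k).le _) x
  have hBi : ∀ k, Integrable (B k) := fun k =>
    (integrable_indicator_iff Metric.isClosed_closedBall.measurableSet).2
      (integrableOn_const (isCompact_closedBall _ _).measure_lt_top.ne)
  have hBlim : Tendsto (fun k => ∫ x, B k x) atTop (nhds 0) := aux_ball n hn
  -- pointwise bound
  have hub : ∀ k x, u x ^ 2 * ‖fderiv ℝ (η k) x‖ ^ 2 ≤ M ^ 2 * ((S k).indicator F x + B k x) := by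
    intro k x
    have hrhs : 0 ≤ M ^ 2 * ((S k).indicator F x + B k x) :=
      mul_nonneg (sq_nonneg _) (add_nonneg (Set.indicator_nonneg (fun y _ => (hF0 y).le) x) (hB0 k x))
    by_cases h1 : ‖x‖ < (k : ℝ) + 1
    · rw [hηz1 k x h1]; simpa using hrhs
    by_cases h2 : 2 * ((k : ℝ) + 1) < ‖x‖
    · rw [hηz2 k x h2]; simpa using hrhs
    have e1 : (S k).indicator F x = F x := Set.indicator_of_mem (show x ∈ S k from not_lt.1 h1) _
    have e2 : B k x = ((k : ℝ) + 1) ^ (-n) := Set.indicator_of_mem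
      (show x ∈ Metric.closedBall _ _ by rw [mem_closedBall_zero_iff]; exact not_lt.1 h2) _
    rw [e1, e2]
    have hy := aux_young n (by linarith) (u x) ((k : ℝ) + 1) (hpos x) (hk0 k)
    calc u x ^ 2 * ‖fderiv ℝ (η k) x‖ ^ 2 ≤ u x ^ 2 * (M / ((k : ℝ) + 1)) ^ 2 := by
          gcongr; exact hηM k x
      _ = M ^ 2 * (u x ^ 2 / ((k : ℝ) + 1) ^ 2) := by rw [div_pow]; ring
      _ ≤ _ := by gcongr
  -- identity 1
  let P : ℕ → EuclideanSpace ℝ (Fin d) → ℝ := fun k x =>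
    ∑ i, fderiv ℝ (η k) x (EuclideanSpace.single i 1) * w x i
  have hP : ∀ k x, |P k x| ≤ ‖fderiv ℝ (η k) x‖ * Real.sqrt (G x) := fun k x => aux_cs _ _
  have hηsq : ∀ k, HasCompactSupport (fun x => η k x ^ 2) := fun k => by
    simp_rw [pow_two]; exact (hηc k).mul_right
  have hcompB : ∀ k (g : EuclideanSpace ℝ (Fin d) → ℝ), Continuous g →
      Integrable (fun x => η k x ^ 2 * g x) := fun k g hg =>
    (((hηC k).continuous.pow 2).mul hg).integrable_of_hasCompactSupport (hηsq k).mul_right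
  have hcompA : ∀ k (g : EuclideanSpace ℝ (Fin d) → ℝ), Continuous g →
      Integrable (fun x => η k x * g x) := fun k g hg =>
    ((hηC k).continuous.mul hg).integrable_of_hasCompactSupport (hηc k).mul_right
  have id1 : ∀ k, (∫ x, η k x ^ 2 * G x) - ∫ x, η k x ^ 2 * F x =
      - ∫ x, 2 * η k x * u x * P k x := by
    intro k
    have h := aux_ibp (fun x => η k x ^ 2) ((hηC k).pow 2) (hηsq k)
      (fun i x => u x * fderiv ℝ u x (EuclideanSpace.single i 1))
      (fun i => (hu.of_le (by norm_num)).mul ((aux_ui_contDiff u hu _).of_le (by norm_num)))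
    rw [← integral_sub (hcompB k G hGc) (hcompB k F hFc)]
    refine Eq.trans (integral_congr_ae (Eventually.of_forall fun x => ?_))
      (h.trans (congrArg Neg.neg (integral_congr_ae (Eventually.of_forall fun x => ?_)).symm))
    · beta_reduce
      rw [aux_div1 u hu x]
      have h1 : lapl u x = - u x ^ (q - 1) := by have := heq x; rw [hq1] at this; linarith
      have h2 : u x * u x ^ (q - 1) = F x := by
        rw [hFdef]; simp only
        rw [Real.rpow_sub_one (hpos x).ne']; field_simp [(hpos x).ne']
      rw [h1, mul_neg, h2]
      simp only [hG, hw]; ring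
    · simp only [P]
      rw [Finset.mul_sum]
      refine Finset.sum_congr rfl fun i _ => ?_
      have hd : DifferentiableAt ℝ (η k) x := (hηC k).differentiable (by norm_num) x
      have : fderiv ℝ (fun x => η k x ^ 2) x = (2 * η k x) • fderiv ℝ (η k) x := by
        rw [fderiv_fun_pow 2 hd]; simp
      rw [this]
      simp only [_root_.smul_apply, smul_eq_mul, hw]
      ring
  have hmix : ∀ k x, |2 * η k x * u x * P k x| ≤
      (S k).indicator (fun x => η k x ^ 2 * G x) x / 2
        + 2 * (M ^ 2 * ((S k).indicator F x + B k x)) := by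
    intro k x
    have hrhs : 0 ≤ 2 * (M ^ 2 * ((S k).indicator F x + B k x)) :=
      mul_nonneg zero_le_two (mul_nonneg (sq_nonneg _)
        (add_nonneg (Set.indicator_nonneg (fun y _ => (hF0 y).le) x) (hB0 k x)))
    by_cases h1 : ‖x‖ < (k : ℝ) + 1
    · have : P k x = 0 := by simp only [P]; rw [hηz1 k x h1]; simp
      rw [this, mul_zero, abs_zero]
      exact add_nonneg (div_nonneg (Set.indicator_nonneg
        (fun y _ => mul_nonneg (sq_nonneg _) (hG0 y)) x) zero_le_two) hrhs
    rw [Set.indicator_of_mem (show x ∈ S k from not_lt.1 h1) (fun x => η k x ^ 2 * G x)]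
    have h2 := hub k x
    have h3 := hP k x
    have hs := Real.sq_sqrt (hG0 x)
    set s := Real.sqrt (G x)
    set a := ‖fderiv ℝ (η k) x‖
    rw [abs_mul, abs_of_nonneg (mul_nonneg (mul_nonneg zero_le_two (hη0 k x)) (hpos x).le)]
    calc 2 * η k x * u x * |P k x| ≤ 2 * η k x * u x * (a * s) :=
          mul_le_mul_of_nonneg_left h3
            (mul_nonneg (mul_nonneg zero_le_two (hη0 k x)) (hpos x).le)
      _ ≤ η k x ^ 2 * G x / 2 + 2 * (u x ^ 2 * a ^ 2) := by
          rw [← hs]; nlinarith [sq_nonneg (η k x * s - 2 * u x * a)]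
      _ ≤ _ := by linarith
  have hFS : ∀ k, Integrable ((S k).indicator F) := fun k => hF.indicator (hS k)
  have hFSle : ∀ k, ∫ x, (S k).indicator F x ≤ ∫ x, F x := fun k =>
    integral_mono (hFS k) hF fun x => Set.indicator_le_self' (fun y _ => (hF0 y).le) x
  have hFη : ∀ k, ∫ x, η k x ^ 2 * F x ≤ ∫ x, F x := fun k =>
    integral_mono (hcompB k F hFc) hF fun x =>
      mul_le_of_le_one_left (hF0 x).le (pow_le_one₀ (hη0 k x) (hη1 k x))
  have hi2 : ∀ k, Integrable (fun x => 2 * (M ^ 2 * ((S k).indicator F x + B k x))) := fun k =>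
    (((hFS k).add (hBi k)).const_mul _).const_mul _
  have hi2e : ∀ k, ∫ x, 2 * (M ^ 2 * ((S k).indicator F x + B k x)) =
      2 * (M ^ 2 * ((∫ x, (S k).indicator F x) + ∫ x, B k x)) := fun k => by
    rw [integral_const_mul, integral_const_mul, integral_add (hFS k) (hBi k)]
  obtain ⟨b, hb⟩ : ∃ b, ∀ k, ∫ x, B k x ≤ b := by
    obtain ⟨b, hb⟩ := hBlim.bddAbove_range
    exact ⟨b, fun k => hb ⟨k, rfl⟩⟩
  have hGb : ∀ k, ∫ x, η k x ^ 2 * G x ≤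
      2 * (∫ x, F x) + 4 * (M ^ 2 * ((∫ x, F x) + b)) := by
    intro k
    have h1 := id1 k
    have h2 : ‖∫ x, 2 * η k x * u x * P k x‖ ≤
        ∫ x, (η k x ^ 2 * G x / 2 + 2 * (M ^ 2 * ((S k).indicator F x + B k x))) := by
      apply norm_integral_le_of_norm_le (((hcompB k G hGc).div_const 2).add (hi2 k))
      refine Eventually.of_forall fun x => (hmix k x).trans ?_
      have hle : (S k).indicator (fun x => η k x ^ 2 * G x) x ≤ η k x ^ 2 * G x :=
        Set.indicator_le_self' (fun y _ => mul_nonneg (sq_nonneg _) (hG0 y)) x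
      exact add_le_add (div_le_div_of_nonneg_right hle zero_le_two) le_rfl
    rw [integral_add ((hcompB k G hGc).div_const 2) (hi2 k), hi2e, integral_div] at h2
    have h3 := (abs_le.1 h2).1
    have h4 : M ^ 2 * ((∫ x, (S k).indicator F x) + ∫ x, B k x) ≤ M ^ 2 * ((∫ x, F x) + b) := by
      exact mul_le_mul_of_nonneg_left (add_le_add (hFSle k) (hb k)) (sq_nonneg M)
    have h5 := hFη k
    linarith
  have hGi : Integrable G := by
    have hcov : AECover (volume : Measure (EuclideanSpace ℝ (Fin d))) atTop
        (fun k : ℕ => Metric.closedBall (0 : EuclideanSpace ℝ (Fin d)) ((k : ℝ) + 1)) :=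
      aecover_closedBall (tendsto_atTop_add_const_right _ _ tendsto_natCast_atTop_atTop)
    refine hcov.integrable_of_integral_bounded_of_nonneg_ae
      (2 * (∫ x, F x) + 4 * (M ^ 2 * ((∫ x, F x) + b)))
      (fun k => hGc.continuousOn.integrableOn_compact (isCompact_closedBall _ _))
      (Eventually.of_forall hG0) (Eventually.of_forall fun k => le_trans ?_ (hGb k))
    rw [← integral_indicator Metric.isClosed_closedBall.measurableSet]
    refine integral_mono_of_nonneg (Eventually.of_forall fun x =>
      Set.indicator_nonneg (fun y _ => hG0 y) x) (hcompB k G hGc) (Eventually.of_forall fun x => ?_)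
    by_cases hx : x ∈ Metric.closedBall (0 : EuclideanSpace ℝ (Fin d)) ((k : ℝ) + 1)
    · simp only [Set.indicator_of_mem hx]
      rw [hηone k x (mem_closedBall_zero_iff.1 hx)]; simp
    · simp only [Set.indicator_of_notMem hx]
      exact mul_nonneg (sq_nonneg _) (hG0 x)
  have hGS : ∀ k, Integrable ((S k).indicator G) := fun k => hGi.indicator (hS k)
  have hFtail : Tendsto (fun k => ∫ x, (S k).indicator F x) atTop (nhds 0) := aux_tail F hF
  have hGtail : Tendsto (fun k => ∫ x, (S k).indicator G x) atTop (nhds 0) := aux_tail G hGi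
  have hcut2 : ∀ g, Integrable g →
      Tendsto (fun k => ∫ x, η k x ^ 2 * g x) atTop (nhds (∫ x, g x)) := fun g hg =>
    aux_cut g hg (fun k x => η k x ^ 2) (fun k => (hηC k).continuous.pow 2)
      (fun k x => sq_nonneg _) (fun k x => pow_le_one₀ (hη0 k x) (hη1 k x))
      (fun k x hx => by rw [hηone k x hx]; simp)
  have hcut1 : ∀ g, Integrable g →
      Tendsto (fun k => ∫ x, η k x * g x) atTop (nhds (∫ x, g x)) := fun g hg =>
    aux_cut g hg η (fun k => (hηC k).continuous) hη0 hη1 hηone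
  have hGF : ∫ x, G x = ∫ x, F x := by
    have hlim := (hcut2 G hGi).sub (hcut2 F hF)
    have hz : Tendsto (fun k => - ∫ x, 2 * η k x * u x * P k x) atTop (nhds 0) := by
      rw [← neg_zero]
      apply Tendsto.neg
      have hbound : Tendsto (fun k => (∫ x, (S k).indicator G x) / 2 +
          2 * (M ^ 2 * ((∫ x, (S k).indicator F x) + ∫ x, B k x))) atTop (nhds 0) := by
        have := (hGtail.div_const 2).add (((hFtail.add hBlim).const_mul (M ^ 2)).const_mul 2)
        simpa using this
      refine squeeze_zero_norm (fun k => ?_) hbound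
      rw [← hi2e, ← integral_div, ← integral_add ((hGS k).div_const 2) (hi2 k)]
      apply norm_integral_le_of_norm_le (((hGS k).div_const 2).add (hi2 k))
      refine Eventually.of_forall fun x => (hmix k x).trans ?_
      have hle : (S k).indicator (fun x => η k x ^ 2 * G x) x ≤ (S k).indicator G x :=
        Set.indicator_le_indicator
          (mul_le_of_le_one_left (hG0 x) (pow_le_one₀ (hη0 k x) (hη1 k x)))
      exact add_le_add (div_le_div_of_nonneg_right hle zero_le_two) le_rfl
    have := tendsto_nhds_unique hlim (hz.congr fun k => (id1 k).symm)
    linarith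
  -- identity 2
  have id2 : ∀ k, (1 - (d : ℝ) / 2) * (∫ x, η k x * G x) + d / q * ∫ x, η k x * F x =
      - ∫ x, ∑ i, fderiv ℝ (η k) x (EuclideanSpace.single i 1) * pohoV u q i x := by
    intro k
    rw [← aux_ibp (η k) (hηC k) (hηc k) (pohoV u q) (aux_pohoV_contDiff u hu hpos q),
      ← integral_const_mul, ← integral_const_mul,
      ← integral_add ((hcompA k G hGc).const_mul _) ((hcompA k F hFc).const_mul _)]
    congr 1
    ext x
    rw [aux_div2 u hu hpos q (by linarith) x (by rw [← hq1]; exact heq x)]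
    simp only [hG, hw, hFdef]; ring
  have hpb : ∀ k x, |∑ i, fderiv ℝ (η k) x (EuclideanSpace.single i 1) * pohoV u q i x| ≤
      2 * M * (2 * (S k).indicator G x + (S k).indicator F x) := by
    intro k x
    have hrhs : 0 ≤ 2 * M * (2 * (S k).indicator G x + (S k).indicator F x) :=
      mul_nonneg (by positivity) (add_nonneg (mul_nonneg zero_le_two
        (Set.indicator_nonneg (fun y _ => hG0 y) x)) (Set.indicator_nonneg (fun y _ => (hF0 y).le) x))
    by_cases h1 : ‖x‖ < (k : ℝ) + 1
    · rw [hηz1 k x h1]; simpa using hrhs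
    by_cases h2 : 2 * ((k : ℝ) + 1) < ‖x‖
    · rw [hηz2 k x h2]; simpa using hrhs
    have hx : x ∈ S k := not_lt.1 h1
    rw [Set.indicator_of_mem hx, Set.indicator_of_mem hx]
    have hC : ∑ i, fderiv ℝ (η k) x (EuclideanSpace.single i 1) * x i = fderiv ℝ (η k) x x :=
      aux_sum_clm _ _
    have hCb : |fderiv ℝ (η k) x x| ≤ ‖fderiv ℝ (η k) x‖ * ‖x‖ := (fderiv ℝ (η k) x).le_opNorm x
    have hPb := hP k x
    have hA : |∑ j, x j * w x j| ≤ ‖x‖ * Real.sqrt (G x) := by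
      rw [EuclideanSpace.norm_eq, ← Real.sqrt_mul (Finset.sum_nonneg fun i _ => sq_nonneg _)]
      apply Real.abs_le_sqrt
      simpa using Finset.sum_mul_sq_le_sq_mul_sq Finset.univ (fun j => x j) (w x)
    have hax : ‖fderiv ℝ (η k) x‖ * ‖x‖ ≤ 2 * M := by
      calc ‖fderiv ℝ (η k) x‖ * ‖x‖ ≤ M / ((k : ℝ) + 1) * (2 * ((k : ℝ) + 1)) := by
            gcongr
            · exact hηM k x
            · exact not_lt.1 h2
        _ = 2 * M := by field_simp [(hk0 k).ne']
    have hexp : ∑ i, fderiv ℝ (η k) x (EuclideanSpace.single i 1) * pohoV u q i x =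
        (∑ j, x j * w x j) * P k x - fderiv ℝ (η k) x x * (G x / 2 - F x / q) := by
      rw [← hC]
      simp only [P, pohoV]
      rw [Finset.mul_sum, Finset.sum_mul, ← Finset.sum_sub_distrib]
      refine Finset.sum_congr rfl fun i _ => ?_
      simp only [hG, hFdef, hw]
      ring
    rw [hexp]
    have hs := Real.mul_self_sqrt (hG0 x)
    have hFq : F x / q ≤ F x := div_le_self (hF0 x).le hq2
    have hFq0 : 0 ≤ F x / q := div_nonneg (hF0 x).le (by linarith)
    have hGx := hG0 x
    have hin : |G x / 2 - F x / q| ≤ G x + F x := by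
      rw [abs_le]; constructor <;> linarith
    set s := Real.sqrt (G x)
    set a := ‖fderiv ℝ (η k) x‖
    calc |(∑ j, x j * w x j) * P k x - fderiv ℝ (η k) x x * (G x / 2 - F x / q)|
        ≤ |∑ j, x j * w x j| * |P k x| + |fderiv ℝ (η k) x x| * |G x / 2 - F x / q| := by
          rw [← abs_mul, ← abs_mul]; exact abs_sub _ _
      _ ≤ (‖x‖ * s) * (a * s) + (a * ‖x‖) * (G x + F x) := by gcongr
      _ = (a * ‖x‖) * (2 * G x + F x) := by rw [← hs]; ring
      _ ≤ _ := by
          apply mul_le_mul_of_nonneg_right hax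
          have := (hF0 x).le
          linarith
  have hpoho : (1 - (d : ℝ) / 2) * (∫ x, G x) + d / q * ∫ x, F x = 0 := by
    have hlim := ((hcut1 G hGi).const_mul (1 - (d : ℝ) / 2)).add ((hcut1 F hF).const_mul (d / q))
    have hz : Tendsto (fun k => - ∫ x, ∑ i, fderiv ℝ (η k) x (EuclideanSpace.single i 1)
        * pohoV u q i x) atTop (nhds 0) := by
      rw [← neg_zero]
      apply Tendsto.neg
      have hbound : Tendsto (fun k => 2 * M * (2 * (∫ x, (S k).indicator G x)
          + ∫ x, (S k).indicator F x)) atTop (nhds 0) := by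
        simpa using ((hGtail.const_mul 2).add hFtail).const_mul (2 * M)
      refine squeeze_zero_norm (fun k => ?_) hbound
      rw [← integral_const_mul, ← integral_add ((hGS k).const_mul 2) (hFS k),
        ← integral_const_mul]
      exact norm_integral_le_of_norm_le ((((hGS k).const_mul 2).add (hFS k)).const_mul (2 * M))
        (Eventually.of_forall fun x => hpb k x)
    exact tendsto_nhds_unique hlim (hz.congr fun k => (id2 k).symm)
  have hIpos : 0 < ∫ x, F x := by
    rw [integral_pos_iff_support_of_nonneg (fun x => (hF0 x).le) hF]
    have : Function.support F = Set.univ := by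
      ext x; simp [(hF0 x).ne']
    rw [this]
    exact Measure.measure_univ_pos.2 (NeZero.ne _)
  rw [hGF, ← add_mul] at hpoho
  have h0 := (mul_eq_zero.1 hpoho).resolve_right hIpos.ne'
  rw [hq] at h0
  have hnpos : 0 < n := by linarith
  field_simp at h0
  nlinarith

/-- Euclidean-base instance of Theorem 2.5 iv): under Ric_{n,d} ≥ 0 with virtual
dimension n > d (on flat ℝ^d: Hess f[ξ,ξ] ≥ (∇f·ξ)²/(n−d)), there is no positive
finite-weighted-energy solution of the n-critical Lane-Emden equation. -/
theorem no_critical_solution_finiteEnergy_virtualDim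
    (d : ℕ) (hd : 3 ≤ d) (n : ℝ) (hn : (d : ℝ) < n)
    (f : EuclideanSpace ℝ (Fin d) → ℝ) (hf : ContDiff ℝ 2 f)
    (hBE : ∀ x ξ : EuclideanSpace ℝ (Fin d),
      ⟪gradient f x, ξ⟫ ^ 2 / (n - (d : ℝ)) ≤ iteratedFDeriv ℝ 2 f x ![ξ, ξ]) :
    ¬ ∃ u : EuclideanSpace ℝ (Fin d) → ℝ,
        ContDiff ℝ 3 u ∧ (∀ x, 0 < u x) ∧
        (∀ x, lapl u x - ⟪gradient f x, gradient u x⟫ + u x ^ ((n + 2) / (n - 2)) = 0) ∧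
        (∫⁻ x, ENNReal.ofReal (Real.exp (-f x) * u x ^ (2 * n / (n - 2)))) < ⊤ := by
  rintro ⟨u, hu, hpos, heq, hE⟩
  have hz : ∀ x ξ, fderiv ℝ f x ξ = 0 := aux_fderiv_zero (n - d) (by linarith) f hf hBE
  have hz' : ∀ x, fderiv ℝ f x = 0 := fun x => by ext ξ; simpa using hz x ξ
  have hgz : ∀ x, gradient f x = 0 := fun x => by simp [gradient, hz' x]
  have hconst : ∀ x, f x = f 0 := fun x =>
    is_const_of_fderiv_eq_zero (hf.differentiable (by norm_num)) hz' x 0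
  refine aux_core hd n hn u hu hpos (fun x => ?_) ?_
  · have := heq x
    rw [hgz x, inner_zero_left, sub_zero] at this
    exact this
  · have hc : Continuous (fun x => u x ^ (2 * n / (n - 2))) :=
      hu.continuous.rpow_const (fun x => Or.inl (hpos x).ne')
    have hi : Integrable (fun x => Real.exp (-f x) * u x ^ (2 * n / (n - 2))) := by
      refine ⟨(hf.continuous.neg.rexp.mul hc).aestronglyMeasurable, ?_⟩
      rw [hasFiniteIntegral_iff_ofReal (Eventually.of_forall fun x =>
        mul_nonneg (Real.exp_pos _).le (Real.rpow_nonneg (hpos x).le _))]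
      exact hE
    have h2 := hi.const_mul (Real.exp (f 0))
    refine h2.congr (Eventually.of_forall fun x => ?_)
    simp only
    rw [hconst x, ← mul_assoc, ← Real.exp_add]
    simp
end
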